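/- arXiv:2009.12884 — 2 statements merged into one kernel-verified Lean document; each statement's English description precedes it below -/
import Mathlib

section
/- Global well-posedness of nonlinear YDEs with C^{1+β} drift: Let α, β ∈ (0,1) with α(1+β) > 1 and A ∈ C^α_t C^{1+β}_V. Then for every x₀ ∈ V there exists exactly one x ∈ C^α([0,T];V) with x(0) = x₀ such that for some K ≥ 0, ‖x_t − x_s − A_{s,t}(x_s)‖_V ≤ K(t−s)^{α(1+β)} for all 0 ≤ s ≤ t ≤ T (i.e. a unique solution of the YDE x_t = x₀ + ∫_0^t A(ds,x_s)). Moreover, for any γ ∈ (0,1) with α + βγ > 1, any path y ∈ C^γ([0,T];V) with y(0) = x₀ satisfying ‖y_t − y_s − A_{s,t}(y_s)‖_V ≤ K'(t−s)^{α+βγ} for some K' coincides with x. -/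
open Filter Topology

/-- The time-regularity, Lipschitz and four-point bounds of a field `A ∈ C^α_t C^{1+β}` on
`[0, T]`, expressed without spatial derivatives. -/
structure IsYoungField {V : Type*} [NormedAddCommGroup V] (A : ℝ → V → V) (α β M T : ℝ) :
    Prop where
  nonneg : 0 ≤ M
  bound : ∀ s t : ℝ, ∀ z : V, 0 ≤ s → s ≤ t → t ≤ T → ‖A t z - A s z‖ ≤ M * (t - s) ^ α
  lip : ∀ s t : ℝ, ∀ z w : V, 0 ≤ s → s ≤ t → t ≤ T →
    ‖A t z - A s z - (A t w - A s w)‖ ≤ M * (t - s) ^ α * ‖z - w‖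
  four : ∀ s t : ℝ, ∀ x y x' y' : V, 0 ≤ s → s ≤ t → t ≤ T →
    ‖(A t x - A s x) - (A t y - A s y) - ((A t x' - A s x') - (A t y' - A s y'))‖ ≤
      M * (t - s) ^ α * (‖(x - y) - (x' - y')‖ + ‖x' - y'‖ * (‖x - x'‖ + ‖y - y'‖) ^ β)

theorem IsYoungField.rescale {V : Type*} [NormedAddCommGroup V] {A : ℝ → V → V} {α β M T : ℝ}
    (hA : IsYoungField A α β M T) {a l : ℝ} (ha : 0 ≤ a) (hl : 0 ≤ l) (hal : a + l ≤ T) :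
    IsYoungField (fun r z => A (a + l * r) z) α β (M * l ^ α) 1 := by
  have key : ∀ s t : ℝ, s ≤ t → M * l ^ α * (t - s) ^ α
      = M * (a + l * t - (a + l * s)) ^ α := by
    intro s t hst
    rw [show a + l * t - (a + l * s) = l * (t - s) by ring,
      Real.mul_rpow hl (by linarith)]
    ring
  have h1 : ∀ s : ℝ, 0 ≤ s → 0 ≤ a + l * s := fun s hs => by positivity
  have h2 : ∀ s t : ℝ, s ≤ t → a + l * s ≤ a + l * t := fun s t hst => by gcongr
  have h3 : ∀ t : ℝ, t ≤ 1 → a + l * t ≤ T := fun t ht => by nlinarith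
  refine ⟨mul_nonneg hA.nonneg (Real.rpow_nonneg hl _), ?_, ?_, ?_⟩
  · intro s t z hs hst ht
    rw [key s t hst]
    exact hA.bound _ _ _ (h1 s hs) (h2 s t hst) (h3 t ht)
  · intro s t z w hs hst ht
    rw [key s t hst]
    exact hA.lip _ _ _ _ (h1 s hs) (h2 s t hst) (h3 t ht)
  · intro s t x y x' y' hs hst ht
    rw [key s t hst]
    exact hA.four _ _ _ _ _ _ (h1 s hs) (h2 s t hst) (h3 t ht)

/-- Mean value estimate for a second-order difference of a differentiable map. -/
theorem norm_four_point_le {V : Type*} [NormedAddCommGroup V] [NormedSpace ℝ V]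
    {f : V → V} {f' : V → V →L[ℝ] V} {c β : ℝ} (hβ : 0 ≤ β)
    (hf : ∀ z, HasFDerivAt f (f' z) z) (hb : ∀ z, ‖f' z‖ ≤ c)
    (hh : ∀ z w, ‖f' z - f' w‖ ≤ c * ‖z - w‖ ^ β) (x y x' y' : V) :
    ‖f x - f y - (f x' - f y')‖ ≤
      c * (‖(x - y) - (x' - y')‖ + ‖x' - y'‖ * (‖x - x'‖ + ‖y - y'‖) ^ β) := by
  have hc : 0 ≤ c := (norm_nonneg _).trans (hb x)
  let g : ℝ → V := fun r => f (y + r • (x - y)) - f (y' + r • (x' - y'))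
  let g' : ℝ → V := fun r => f' (y + r • (x - y)) (x - y) - f' (y' + r • (x' - y')) (x' - y')
  have hline : ∀ (p q : V) (r : ℝ), HasDerivAt (fun r : ℝ => p + r • q) q r := by
    intro p q r
    simpa using ((hasDerivAt_id r).smul_const q).const_add p
  have hg : ∀ r : ℝ, HasDerivAt g (g' r) r := by
    intro r
    exact ((hf _).comp_hasDerivAt r (hline y (x - y) r)).sub
      ((hf _).comp_hasDerivAt r (hline y' (x' - y') r))
  have hbd : ∀ r ∈ Set.Ico (0 : ℝ) 1, ‖g' r‖ ≤
      c * (‖(x - y) - (x' - y')‖ + ‖x' - y'‖ * (‖x - x'‖ + ‖y - y'‖) ^ β) := by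
    intro r hr
    have e : g' r = f' (y + r • (x - y)) ((x - y) - (x' - y'))
        + (f' (y + r • (x - y)) - f' (y' + r • (x' - y'))) (x' - y') := by
      simp only [g', map_sub, sub_apply]
      abel
    have e2 : (y + r • (x - y)) - (y' + r • (x' - y')) = (1 - r) • (y - y') + r • (x - x') := by
      module
    have hp : ‖(y + r • (x - y)) - (y' + r • (x' - y'))‖ ≤ ‖x - x'‖ + ‖y - y'‖ := by
      rw [e2]
      refine (norm_add_le _ _).trans ?_
      rw [norm_smul, norm_smul, Real.norm_of_nonneg hr.1,
        Real.norm_of_nonneg (by linarith [hr.2] : (0 : ℝ) ≤ 1 - r)]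
      nlinarith [norm_nonneg (x - x'), norm_nonneg (y - y'), hr.1, hr.2]
    rw [e, mul_add]
    refine (norm_add_le _ _).trans (add_le_add ?_ ?_)
    · exact (ContinuousLinearMap.le_opNorm _ _).trans (by gcongr; exact hb _)
    · refine (ContinuousLinearMap.le_opNorm _ _).trans ?_
      rw [mul_comm ‖x' - y'‖, ← mul_assoc]
      gcongr
      exact (hh _ _).trans (by gcongr)
  have := norm_image_sub_le_of_norm_deriv_le_segment_01'
    (fun r _ => (hg r).hasDerivWithinAt) hbd
  have e : g 1 - g 0 = f x - f y - (f x' - f y') := by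
    simp only [g, one_smul, zero_smul, add_zero, add_sub_cancel]
    abel
  rwa [e] at this

/-- The constant of the discrete sewing lemma. -/
noncomputable def sewConst (p : ℝ) : ℝ := 1 / (1 - (2 / 3 : ℝ) ^ (p - 1))

theorem two_thirds_rpow_lt_one {p : ℝ} (hp : 1 < p) : (2 / 3 : ℝ) ^ (p - 1) < 1 :=
  Real.rpow_lt_one (by norm_num) (by norm_num) (by linarith)

theorem one_le_sewConst {p : ℝ} (hp : 1 < p) : 1 ≤ sewConst p := by
  have h1 := two_thirds_rpow_lt_one hp
  have h0 : 0 < (2 / 3 : ℝ) ^ (p - 1) := by positivity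
  rw [sewConst, le_div_iff₀ (by linarith)]
  linarith

theorem sewConst_mul_add_one {p : ℝ} (hp : 1 < p) :
    sewConst p * (2 / 3 : ℝ) ^ (p - 1) + 1 = sewConst p := by
  have h1 := two_thirds_rpow_lt_one hp
  have : 1 - (2 / 3 : ℝ) ^ (p - 1) ≠ 0 := by linarith
  rw [sewConst]
  field_simp
  ring

theorem rpow_add_rpow_le_of_le_two_thirds {a b p : ℝ} (ha : 0 ≤ a) (hb : 0 ≤ b) (hp : 1 < p)
    (ha' : a ≤ 2 / 3 * (a + b)) (hb' : b ≤ 2 / 3 * (a + b)) :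
    a ^ p + b ^ p ≤ (2 / 3 : ℝ) ^ (p - 1) * (a + b) ^ p := by
  have split : ∀ r : ℝ, 0 ≤ r → r ^ p = r ^ (p - 1) * r := by
    intro r hr
    rw [← Real.rpow_add_one' hr (by linarith)]
    ring_nf
  have hq : 0 ≤ p - 1 := by linarith
  have h1 : ∀ r : ℝ, 0 ≤ r → r ≤ 2 / 3 * (a + b) →
      r ^ p ≤ (2 / 3 : ℝ) ^ (p - 1) * (a + b) ^ (p - 1) * r := by
    intro r hr hr'
    rw [split r hr, ← Real.mul_rpow (by norm_num) (by positivity)]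
    gcongr
  calc a ^ p + b ^ p ≤ (2 / 3 : ℝ) ^ (p - 1) * (a + b) ^ (p - 1) * a
        + (2 / 3 : ℝ) ^ (p - 1) * (a + b) ^ (p - 1) * b := add_le_add (h1 a ha ha') (h1 b hb hb')
    _ = (2 / 3 : ℝ) ^ (p - 1) * (a + b) ^ p := by rw [split (a + b) (by positivity)]; ring

/-- Discrete sewing lemma on a uniform grid of mesh `h`. -/
theorem discrete_sewing {V : Type*} [NormedAddCommGroup V] {p K h : ℝ} (hp : 1 < p)
    (hh : 0 ≤ h) (hK : 0 ≤ K) {n : ℕ} (R : ℕ → ℕ → V)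
    (hR : ∀ i, i + 1 ≤ n → ‖R i (i + 1)‖ ≤ K * h ^ p)
    (hδ : ∀ i u j, i < u → u < j → j ≤ n →
      ‖R i j - R i u - R u j‖ ≤ K * (((j : ℝ) - i) * h) ^ p) :
    ∀ i j, i < j → j ≤ n → ‖R i j‖ ≤ sewConst p * K * (((j : ℝ) - i) * h) ^ p := by
  have hC := one_le_sewConst hp
  suffices H : ∀ m i : ℕ, 1 ≤ m → i + m ≤ n →
      ‖R i (i + m)‖ ≤ sewConst p * K * ((m : ℝ) * h) ^ p by
    intro i j hij hj
    have := H (j - i) i (by omega) (by omega)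
    rwa [Nat.add_sub_of_le hij.le, Nat.cast_sub hij.le] at this
  intro m
  induction m using Nat.strong_induction_on with
  | _ m ih =>
    intro i hm hi
    rcases Nat.lt_or_ge 1 m with h1 | h1
    · obtain ⟨a, b, ha, hb, hab, hlea, hleb⟩ : ∃ a b : ℕ, 1 ≤ a ∧ 1 ≤ b ∧ a + b = m ∧
          3 * a ≤ 2 * m ∧ 3 * b ≤ 2 * m :=
        ⟨m / 2, m - m / 2, by omega, by omega, by omega, by omega, by omega⟩
      have iha := ih a (by omega) i ha (by omega)
      have ihb := ih b (by omega) (i + a) hb (by omega)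
      have hd := hδ i (i + a) (i + a + b) (by omega) (by omega) (by omega)
      subst hab
      rw [← add_assoc]
      have hlea' : (3 : ℝ) * a ≤ 2 * (a + b) := by exact_mod_cast hlea
      have hleb' : (3 : ℝ) * b ≤ 2 * (a + b) := by exact_mod_cast hleb
      have hsum := rpow_add_rpow_le_of_le_two_thirds (a := (a : ℝ) * h) (b := (b : ℝ) * h)
        (by positivity) (by positivity) hp (by nlinarith) (by nlinarith)
      have e : ((i + a + b : ℕ) : ℝ) - i = (a : ℝ) + b := by push_cast; ring
      rw [e] at hd
      have e3 : ((a + b : ℕ) : ℝ) * h = (a : ℝ) * h + b * h := by push_cast; ring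
      have e4 : ((a : ℝ) + b) * h = (a : ℝ) * h + b * h := by ring
      rw [e3]
      rw [e4] at hd
      set W := ((a : ℝ) * h + b * h) ^ p
      have htri : ‖R i (i + a + b)‖ ≤ ‖R i (i + a + b) - R i (i + a) - R (i + a) (i + a + b)‖
          + ‖R i (i + a)‖ + ‖R (i + a) (i + a + b)‖ := by
        have := norm_add₃_le (a := R i (i + a + b) - R i (i + a) - R (i + a) (i + a + b))
          (b := R i (i + a)) (c := R (i + a) (i + a + b))
        refine le_trans (le_of_eq ?_) this
        congr 1
        abel
      calc ‖R i (i + a + b)‖ ≤ K * W + sewConst p * K * ((a : ℝ) * h) ^ p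
            + sewConst p * K * ((b : ℝ) * h) ^ p := by linarith
        _ = K * W + sewConst p * K * (((a : ℝ) * h) ^ p + ((b : ℝ) * h) ^ p) := by ring
        _ ≤ K * W + sewConst p * K * ((2 / 3 : ℝ) ^ (p - 1) * W) := by gcongr
        _ = (sewConst p * (2 / 3 : ℝ) ^ (p - 1) + 1) * K * W := by ring
        _ = sewConst p * K * W := by rw [sewConst_mul_add_one hp]
    · obtain rfl : m = 1 := by omega
      have h2 : 0 ≤ K * h ^ p := by positivity
      calc ‖R i (i + 1)‖ ≤ K * h ^ p := hR i hi
        _ ≤ sewConst p * (K * h ^ p) := le_mul_of_one_le_left h2 hC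
        _ = _ := by rw [Nat.cast_one, one_mul, mul_assoc]

/-- A discrete Hölder constant which can always be improved from `N` to `N / 2 + c` may be
taken to be `2 * c`. -/
theorem discrete_holder_of_improve {V : Type*} [NormedAddCommGroup V] {α h c : ℝ}
    (hα : 0 ≤ α) (hh : 0 < h) (hc : 0 ≤ c) {n : ℕ} (v : ℕ → V)
    (H : ∀ N : ℝ, 0 ≤ N →
      (∀ i j : ℕ, i < j → j ≤ n → ‖v j - v i‖ ≤ N * (((j : ℝ) - i) * h) ^ α) →
      ∀ i j : ℕ, i < j → j ≤ n → ‖v j - v i‖ ≤ (N / 2 + c) * (((j : ℝ) - i) * h) ^ α) :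
    ∀ i j : ℕ, i < j → j ≤ n → ‖v j - v i‖ ≤ 2 * c * (((j : ℝ) - i) * h) ^ α := by
  obtain ⟨N, hN0, hN⟩ : ∃ N : ℝ, 0 ≤ N ∧
      ∀ i j : ℕ, i < j → j ≤ n → ‖v j - v i‖ ≤ N * (((j : ℝ) - i) * h) ^ α := by
    refine ⟨(∑ k ∈ Finset.range (n + 1), 2 * ‖v k‖) / h ^ α, by positivity, ?_⟩
    intro i j hij hj
    have hmem : ∀ k ≤ n, 2 * ‖v k‖ ≤ ∑ k ∈ Finset.range (n + 1), 2 * ‖v k‖ := fun k hk =>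
      Finset.single_le_sum (f := fun k => 2 * ‖v k‖) (fun _ _ => by positivity)
        (Finset.mem_range.2 (by omega))
    have h1 := hmem i (by omega)
    have h2 := hmem j hj
    have h3 := norm_sub_le (v j) (v i)
    have h4 : (1 : ℝ) ≤ (j : ℝ) - i := by
      have : (i : ℝ) + 1 ≤ j := by exact_mod_cast hij
      linarith
    have h5 : h ^ α ≤ (((j : ℝ) - i) * h) ^ α :=
      Real.rpow_le_rpow hh.le (le_mul_of_one_le_left hh.le h4) hα
    rw [div_mul_eq_mul_div, le_div_iff₀ (by positivity)]
    gcongr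
    linarith
  have hiter : ∀ k : ℕ, ∀ i j : ℕ, i < j → j ≤ n →
      ‖v j - v i‖ ≤ (2 * c + N * (1 / 2) ^ k) * (((j : ℝ) - i) * h) ^ α := by
    intro k
    induction k with
    | zero =>
      intro i j hij hj
      refine (hN i j hij hj).trans ?_
      have h0 : (0 : ℝ) ≤ (j : ℝ) - i := by
        have : (i : ℝ) ≤ j := by exact_mod_cast hij.le
        linarith
      gcongr
      simp [hc]
    | succ k ih =>
      have := H _ (by positivity) ih
      intro i j hij hj
      refine (this i j hij hj).trans (le_of_eq ?_)
      rw [pow_succ]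
      ring
  intro i j hij hj
  have hlim : Tendsto (fun k : ℕ => (2 * c + N * (1 / 2) ^ k) * (((j : ℝ) - i) * h) ^ α) atTop
      (𝓝 ((2 * c + N * 0) * (((j : ℝ) - i) * h) ^ α)) :=
    (((tendsto_pow_atTop_nhds_zero_of_lt_one (by norm_num) (by norm_num)).const_mul N).const_add
      (2 * c)).mul_const _
  rw [mul_zero, add_zero] at hlim
  exact ge_of_tendsto' hlim fun k => hiter k i j hij hj

/-- Perturbed Euler scheme of mesh `h` with `n` steps and one-step errors at most `ε * h ^ p`. -/
def IsEulerChain {V : Type*} [NormedAddCommGroup V] (A : ℝ → V → V) (h ε p : ℝ) (n : ℕ)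
    (x : ℕ → V) : Prop :=
  ∀ k : ℕ, k + 1 ≤ n →
    ‖x (k + 1) - x k - (A (((k + 1 : ℕ) : ℝ) * h) (x k) - A ((k : ℝ) * h) (x k))‖ ≤ ε * h ^ p

theorem grid_pos_le_one {h : ℝ} (hh : 0 < h) {n i j : ℕ} (hn : (n : ℝ) * h ≤ 1) (hij : i < j)
    (hj : j ≤ n) :
    0 ≤ (i : ℝ) * h ∧ (i : ℝ) * h ≤ (j : ℝ) * h ∧ (j : ℝ) * h ≤ 1 ∧
      0 < ((j : ℝ) - i) * h ∧ ((j : ℝ) - i) * h ≤ 1 := by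
  have h1 : (i : ℝ) < j := by exact_mod_cast hij
  have h2 : (j : ℝ) * h ≤ 1 := le_trans (by gcongr) hn
  have h3 : 0 ≤ (i : ℝ) * h := by positivity
  refine ⟨h3, by gcongr, h2, mul_pos (by linarith) hh, ?_⟩
  rw [sub_mul]
  linarith

theorem grid_sub_le {h : ℝ} (hh : 0 < h) {i u j : ℕ} (hiu : i < u) (huj : u < j) :
    0 ≤ ((j : ℝ) - u) * h ∧ ((j : ℝ) - u) * h ≤ ((j : ℝ) - i) * h ∧
      0 ≤ ((u : ℝ) - i) * h ∧ ((u : ℝ) - i) * h ≤ ((j : ℝ) - i) * h := by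
  have h1 : (i : ℝ) < u := by exact_mod_cast hiu
  have h2 : (u : ℝ) < j := by exact_mod_cast huj
  refine ⟨mul_nonneg (by linarith) hh.le, by gcongr, mul_nonneg (by linarith) hh.le, by gcongr⟩

/-- One step of the a priori estimate: a Hölder bound controls the remainder of an Euler chain. -/
theorem IsEulerChain.remainder_le {V : Type*} [NormedAddCommGroup V] {A : ℝ → V → V}
    {α β M h ε p N : ℝ} (hA : IsYoungField A α β M 1) (hα : 0 < α) (hh : 0 < h) (hp : 1 < p)
    (hpα : p ≤ 2 * α) (hε : 0 ≤ ε) (hN : 0 ≤ N) {n : ℕ} (hn : (n : ℝ) * h ≤ 1) {x : ℕ → V}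
    (hx : IsEulerChain A h ε p n x)
    (hxN : ∀ i j : ℕ, i < j → j ≤ n → ‖x j - x i‖ ≤ N * (((j : ℝ) - i) * h) ^ α) :
    ∀ i j : ℕ, i < j → j ≤ n →
      ‖x j - x i - (A ((j : ℝ) * h) (x i) - A ((i : ℝ) * h) (x i))‖ ≤
        sewConst p * (M * N + ε) * (((j : ℝ) - i) * h) ^ p := by
  have hM := hA.nonneg
  refine discrete_sewing hp hh.le (by positivity)
    (fun i j => x j - x i - (A ((j : ℝ) * h) (x i) - A ((i : ℝ) * h) (x i))) ?_ ?_
  · intro i hi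
    refine (hx i hi).trans ?_
    gcongr
    have : 0 ≤ M * N := by positivity
    linarith
  · intro i u j hiu huj hj
    obtain ⟨g1, g2, g3, -, -⟩ := grid_pos_le_one hh hn huj hj
    obtain ⟨-, -, -, g4, g5⟩ := grid_pos_le_one hh hn (hiu.trans huj) hj
    obtain ⟨k1, k2, k3, k4⟩ := grid_sub_le hh hiu huj
    have hl := hA.lip _ _ (x u) (x i) g1 g2 g3
    have hN' := hxN i u hiu (huj.le.trans hj)
    rw [← sub_mul] at hl
    have e : (x j - x i - (A ((j : ℝ) * h) (x i) - A ((i : ℝ) * h) (x i))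
        - (x u - x i - (A ((u : ℝ) * h) (x i) - A ((i : ℝ) * h) (x i)))
        - (x j - x u - (A ((j : ℝ) * h) (x u) - A ((u : ℝ) * h) (x u))))
        = A ((j : ℝ) * h) (x u) - A ((u : ℝ) * h) (x u)
          - (A ((j : ℝ) * h) (x i) - A ((u : ℝ) * h) (x i)) := by abel
    rw [e]
    set w := ((j : ℝ) - i) * h
    calc _ ≤ M * (((j : ℝ) - u) * h) ^ α * ‖x u - x i‖ := hl
      _ ≤ M * w ^ α * (N * w ^ α) := by
        gcongr
        exact hN'.trans (by gcongr)
      _ = M * N * w ^ (2 * α) := by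
        rw [two_mul, Real.rpow_add g4]
        ring
      _ ≤ M * N * w ^ p :=
        mul_le_mul_of_nonneg_left (Real.rpow_le_rpow_of_exponent_ge g4 g5 hpα) (by positivity)
      _ ≤ (M * N + ε) * w ^ p := by gcongr; linarith

/-- A priori Hölder bound for Euler chains of small fields. -/
theorem IsEulerChain.holder {V : Type*} [NormedAddCommGroup V] {A : ℝ → V → V}
    {α β M h ε p : ℝ} (hA : IsYoungField A α β M 1) (hα : 0 < α) (hα1 : α < 1) (hh : 0 < h)
    (hp : 1 < p) (hpα : p ≤ 2 * α) (hε : 0 ≤ ε) (hCM : 8 * (sewConst p * M) ≤ 1)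
    (hCε : 4 * (sewConst p * ε) ≤ 1) {n : ℕ} (hn : (n : ℝ) * h ≤ 1) {x : ℕ → V}
    (hx : IsEulerChain A h ε p n x) :
    ∀ i j : ℕ, i < j → j ≤ n → ‖x j - x i‖ ≤ (((j : ℝ) - i) * h) ^ α := by
  have hM := hA.nonneg
  have hC := one_le_sewConst hp
  have := discrete_holder_of_improve (n := n) hα.le hh (c := 1 / 2) (by norm_num) x ?_
  · simpa using this
  intro N hN hxN i j hij hj
  have hr := hx.remainder_le hA hα hh hp hpα hε hN hn hxN i j hij hj
  obtain ⟨g1, g2, g3, g4, g5⟩ := grid_pos_le_one hh hn hij hj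
  have hb := hA.bound _ _ (x i) g1 g2 g3
  rw [← sub_mul] at hb
  set w := ((j : ℝ) - i) * h
  have hwp : w ^ p ≤ w ^ α := Real.rpow_le_rpow_of_exponent_ge g4 g5 (by linarith)
  have hw0 : 0 ≤ w ^ α := by positivity
  calc ‖x j - x i‖ ≤ ‖x j - x i - (A ((j : ℝ) * h) (x i) - A ((i : ℝ) * h) (x i))‖
        + ‖A ((j : ℝ) * h) (x i) - A ((i : ℝ) * h) (x i)‖ := norm_le_norm_sub_add _ _
    _ ≤ sewConst p * (M * N + ε) * w ^ α + M * w ^ α := by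
      refine add_le_add (hr.trans ?_) hb
      gcongr
    _ = (sewConst p * M * N + sewConst p * ε + M) * w ^ α := by ring
    _ ≤ (N / 2 + 1 / 2) * w ^ α := by
      refine mul_le_mul_of_nonneg_right ?_ hw0
      nlinarith

/-- Stability of Euler chains of small fields with respect to the one-step errors. -/
theorem IsEulerChain.norm_sub_le {V : Type*} [NormedAddCommGroup V] {A : ℝ → V → V}
    {α β M h ε p : ℝ} (hA : IsYoungField A α β M 1) (hα : 0 < α) (hα1 : α < 1) (hβ : 0 < β)
    (hβ1 : β < 1) (hh : 0 < h) (hp : 1 < p) (hpα : p ≤ α * (1 + β)) (hε : 0 ≤ ε)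
    (hCM : 8 * (sewConst p * M) ≤ 1) (hCε : 4 * (sewConst p * ε) ≤ 1) {n : ℕ}
    (hn : (n : ℝ) * h ≤ 1) {x y : ℕ → V} (hx : IsEulerChain A h ε p n x)
    (hy : IsEulerChain A h ε p n y) (hxy : x 0 = y 0) :
    ∀ i : ℕ, i ≤ n → ‖x i - y i‖ ≤ 8 * (sewConst p * ε) := by
  have hM := hA.nonneg
  have hC := one_le_sewConst hp
  have hpα2 : p ≤ 2 * α := by nlinarith
  have hxH := hx.holder hA hα hα1 hh hp hpα2 hε hCM hCε hn
  have hyH := hy.holder hA hα hα1 hh hp hpα2 hε hCM hCε hn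
  have base : ∀ (v : ℕ → V) (N : ℝ), v 0 = 0 → 0 ≤ N →
      (∀ i j : ℕ, i < j → j ≤ n → ‖v j - v i‖ ≤ N * (((j : ℝ) - i) * h) ^ α) →
      ∀ i : ℕ, i ≤ n → ‖v i‖ ≤ N := by
    intro v N hv hN H i hi
    rcases Nat.eq_zero_or_pos i with rfl | hi0
    · simpa [hv] using hN
    · have h1 := H 0 i hi0 hi
      obtain ⟨-, -, -, g4, g5⟩ := grid_pos_le_one hh hn hi0 hi
      rw [hv, sub_zero] at h1
      exact h1.trans (mul_le_of_le_one_right hN (Real.rpow_le_one g4.le g5 hα.le))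
  have hv0 : (fun i => x i - y i) 0 = 0 := by simp [hxy]
  have main := discrete_holder_of_improve (n := n) hα.le hh (c := 2 * (sewConst p * ε))
    (by positivity) (fun i => x i - y i) ?_
  · intro i hi
    refine (base _ _ hv0 (by positivity) main i hi).trans ?_
    have : 0 ≤ sewConst p * ε := by positivity
    linarith
  intro N hN hvN
  have hvb := base _ N hv0 hN hvN
  have hr := discrete_sewing (K := 3 * M * N + 2 * ε) (n := n) hp hh.le (by positivity)
    (fun i j => x j - y j - (x i - y i) - ((A ((j : ℝ) * h) (x i) - A ((i : ℝ) * h) (x i))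
      - (A ((j : ℝ) * h) (y i) - A ((i : ℝ) * h) (y i)))) ?_ ?_
  · intro i j hij hj
    have hr' := hr i j hij hj
    obtain ⟨g1, g2, g3, g4, g5⟩ := grid_pos_le_one hh hn hij hj
    have hb := hA.lip _ _ (x i) (y i) g1 g2 g3
    rw [← sub_mul] at hb
    set w := ((j : ℝ) - i) * h
    have hwp : w ^ p ≤ w ^ α := Real.rpow_le_rpow_of_exponent_ge g4 g5 (by linarith)
    have hw0 : 0 ≤ w ^ α := by positivity
    have hvi := hvb i (hij.le.trans hj)
    refine (norm_le_norm_sub_add _ ((A ((j : ℝ) * h) (x i) - A ((i : ℝ) * h) (x i))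
      - (A ((j : ℝ) * h) (y i) - A ((i : ℝ) * h) (y i)))).trans ?_
    calc _ ≤ sewConst p * (3 * M * N + 2 * ε) * w ^ α + M * w ^ α * N := by
          refine add_le_add (hr'.trans ?_) (hb.trans ?_)
          · gcongr
          · gcongr
      _ = (3 * (sewConst p * M) * N + 2 * (sewConst p * ε) + M * N) * w ^ α := by ring
      _ ≤ (N / 2 + 2 * (sewConst p * ε)) * w ^ α := by
        refine mul_le_mul_of_nonneg_right ?_ hw0
        have : M ≤ sewConst p * M := le_mul_of_one_le_left hM hC
        nlinarith
  · intro i hi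
    have e : x (i + 1) - y (i + 1) - (x i - y i)
        - ((A (((i + 1 : ℕ) : ℝ) * h) (x i) - A ((i : ℝ) * h) (x i))
          - (A (((i + 1 : ℕ) : ℝ) * h) (y i) - A ((i : ℝ) * h) (y i)))
        = (x (i + 1) - x i - (A (((i + 1 : ℕ) : ℝ) * h) (x i) - A ((i : ℝ) * h) (x i)))
          - (y (i + 1) - y i - (A (((i + 1 : ℕ) : ℝ) * h) (y i) - A ((i : ℝ) * h) (y i))) := by
      abel
    rw [e]
    refine (_root_.norm_sub_le _ _).trans ?_
    have h1 := hx i hi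
    have h2 := hy i hi
    have h3 : 0 ≤ 3 * M * N * h ^ p := by positivity
    linarith
  · intro i u j hiu huj hj
    obtain ⟨g1, g2, g3, -, -⟩ := grid_pos_le_one hh hn huj hj
    obtain ⟨-, -, -, g4, g5⟩ := grid_pos_le_one hh hn (hiu.trans huj) hj
    obtain ⟨k1, k2, k3, k4⟩ := grid_sub_le hh hiu huj
    have hf := hA.four _ _ (x u) (y u) (x i) (y i) g1 g2 g3
    have hN' := hvN i u hiu (huj.le.trans hj)
    have hvi := hvb i (by omega)
    have hxu := hxH i u hiu (huj.le.trans hj)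
    have hyu := hyH i u hiu (huj.le.trans hj)
    rw [← sub_mul] at hf
    have e : x j - y j - (x i - y i) - ((A ((j : ℝ) * h) (x i) - A ((i : ℝ) * h) (x i))
          - (A ((j : ℝ) * h) (y i) - A ((i : ℝ) * h) (y i)))
        - (x u - y u - (x i - y i) - ((A ((u : ℝ) * h) (x i) - A ((i : ℝ) * h) (x i))
          - (A ((u : ℝ) * h) (y i) - A ((i : ℝ) * h) (y i))))
        - (x j - y j - (x u - y u) - ((A ((j : ℝ) * h) (x u) - A ((u : ℝ) * h) (x u))
          - (A ((j : ℝ) * h) (y u) - A ((u : ℝ) * h) (y u))))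
        = (A ((j : ℝ) * h) (x u) - A ((u : ℝ) * h) (x u))
          - (A ((j : ℝ) * h) (y u) - A ((u : ℝ) * h) (y u))
          - ((A ((j : ℝ) * h) (x i) - A ((u : ℝ) * h) (x i))
          - (A ((j : ℝ) * h) (y i) - A ((u : ℝ) * h) (y i))) := by abel
    rw [e]
    set w := ((j : ℝ) - i) * h
    have hpow : (‖x u - x i‖ + ‖y u - y i‖) ^ β ≤ 2 * w ^ (α * β) := by
      have h1 : (((u : ℝ) - i) * h) ^ α ≤ w ^ α := by gcongr
      calc (‖x u - x i‖ + ‖y u - y i‖) ^ β ≤ (2 * w ^ α) ^ β := by gcongr; linarith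
        _ = 2 ^ β * w ^ (α * β) := by
          rw [Real.mul_rpow (by norm_num) (by positivity), Real.rpow_mul g4.le]
        _ ≤ 2 * w ^ (α * β) := by
          gcongr
          exact Real.rpow_le_self_of_one_le (by norm_num) hβ1.le
    have hαβ : w ^ α ≤ w ^ (α * β) :=
      Real.rpow_le_rpow_of_exponent_ge g4 g5 (by nlinarith)
    calc _ ≤ M * (((j : ℝ) - u) * h) ^ α * (‖(x u - y u) - (x i - y i)‖ +
          ‖x i - y i‖ * (‖x u - x i‖ + ‖y u - y i‖) ^ β) := hf
      _ ≤ M * w ^ α * (N * w ^ (α * β) + N * (2 * w ^ (α * β))) := by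
        gcongr
        calc _ ≤ N * (((u : ℝ) - i) * h) ^ α := hN'
          _ ≤ N * w ^ α := by gcongr
          _ ≤ _ := by gcongr
      _ = 3 * M * N * w ^ (α * (1 + β)) := by
        rw [mul_add α, mul_one, Real.rpow_add g4]
        ring
      _ ≤ 3 * M * N * w ^ p :=
        mul_le_mul_of_nonneg_left (Real.rpow_le_rpow_of_exponent_ge g4 g5 hpα) (by positivity)
      _ ≤ (3 * M * N + 2 * ε) * w ^ p := by gcongr; linarith

/-- The Euler scheme of mesh `h` started at `x₀`. -/
def eulerScheme {V : Type*} [NormedAddCommGroup V] (A : ℝ → V → V) (h : ℝ) (x₀ : V) : ℕ → V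
  | 0 => x₀
  | k + 1 => eulerScheme A h x₀ k + (A (((k + 1 : ℕ) : ℝ) * h) (eulerScheme A h x₀ k)
      - A ((k : ℝ) * h) (eulerScheme A h x₀ k))

theorem isEulerChain_eulerScheme {V : Type*} [NormedAddCommGroup V] (A : ℝ → V → V)
    {h ε : ℝ} (hh : 0 ≤ h) (hε : 0 ≤ ε) (p : ℝ) (n : ℕ) (x₀ : V) :
    IsEulerChain A h ε p n (eulerScheme A h x₀) := by
  intro k _
  rw [eulerScheme]
  simp only [add_sub_cancel_left, sub_self, norm_zero]
  positivity

/-- Every second point of the Euler scheme of mesh `g` is a chain of mesh `2 * g`. -/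
theorem isEulerChain_eulerScheme_two_mul {V : Type*} [NormedAddCommGroup V] {A : ℝ → V → V}
    {α β M g p : ℝ} (hA : IsYoungField A α β M 1) (hα : 0 < α) (hg : 0 < g) {n : ℕ}
    (hn : (n : ℝ) * (2 * g) ≤ 1) (x₀ : V) :
    IsEulerChain A (2 * g) (M ^ 2 * (2 * g) ^ (2 * α - p)) p n
      (fun k => eulerScheme A g x₀ (2 * k)) := by
  intro k hk
  have hM := hA.nonneg
  set X := eulerScheme A g x₀ with hX
  have hk' : ((k : ℝ) + 1) * (2 * g) ≤ 1 := by
    refine le_trans ?_ hn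
    have : (k : ℝ) + 1 ≤ n := by exact_mod_cast hk
    gcongr
  have h1 : X (2 * k + 1) = X (2 * k) + (A ((2 * k + 1) * g) (X (2 * k))
      - A (k * (2 * g)) (X (2 * k))) := by
    rw [hX, eulerScheme, ← hX]
    push_cast
    rw [show (2 * (k : ℝ)) * g = k * (2 * g) by ring]
  have h2 : X (2 * (k + 1)) = X (2 * k + 1) + (A ((k + 1) * (2 * g)) (X (2 * k + 1))
      - A ((2 * k + 1) * g) (X (2 * k + 1))) := by
    rw [show 2 * (k + 1) = 2 * k + 1 + 1 by ring, hX, eulerScheme, ← hX]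
    push_cast
    rw [show (2 * (k : ℝ) + 1 + 1) * g = (k + 1) * (2 * g) by ring]
  have t0 : 0 ≤ (k : ℝ) * (2 * g) := by positivity
  have t1 : (k : ℝ) * (2 * g) ≤ (2 * k + 1) * g := by nlinarith
  have t2 : (2 * (k : ℝ) + 1) * g ≤ (k + 1) * (2 * g) := by nlinarith
  have hb := hA.bound _ _ (X (2 * k)) t0 t1 (t2.trans hk')
  have hl := hA.lip _ _ (X (2 * k + 1)) (X (2 * k)) (t0.trans t1) t2 hk'
  rw [show (2 * (k : ℝ) + 1) * g - k * (2 * g) = g by ring] at hb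
  rw [show ((k : ℝ) + 1) * (2 * g) - (2 * k + 1) * g = g by ring, h1, add_sub_cancel_left,
    ← h1] at hl
  have e : X (2 * (k + 1)) - X (2 * k) - (A (((k + 1 : ℕ) : ℝ) * (2 * g)) (X (2 * k))
      - A ((k : ℝ) * (2 * g)) (X (2 * k)))
      = A ((k + 1) * (2 * g)) (X (2 * k + 1)) - A ((2 * k + 1) * g) (X (2 * k + 1))
        - (A ((k + 1) * (2 * g)) (X (2 * k)) - A ((2 * k + 1) * g) (X (2 * k))) := by
    rw [h2]
    nth_rewrite 1 [h1]
    push_cast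
    abel
  rw [e]
  calc _ ≤ M * g ^ α * (M * g ^ α) := hl.trans (by gcongr)
    _ ≤ M * (2 * g) ^ α * (M * (2 * g) ^ α) := by gcongr <;> linarith
    _ = M ^ 2 * ((2 * g) ^ α * (2 * g) ^ α) := by ring
    _ = M ^ 2 * (2 * g) ^ (2 * α - p) * (2 * g) ^ p := by
      rw [← Real.rpow_add (by positivity), mul_assoc, ← Real.rpow_add (by positivity)]
      ring_nf

theorem IsYoungField.tendsto_increment {V : Type*} [NormedAddCommGroup V] {A : ℝ → V → V}
    {α β M : ℝ} (hA : IsYoungField A α β M 1) (hα : 0 < α) {s t : ℝ} {z : V} {σ τ : ℕ → ℝ}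
    {ζ : ℕ → V} (hs0 : 0 ≤ s) (hst : s ≤ t) (ht1 : t ≤ 1) (hσ0 : ∀ n, 0 ≤ σ n)
    (hσs : ∀ n, σ n ≤ s) (hτ0 : ∀ n, 0 ≤ τ n) (hτt : ∀ n, τ n ≤ t)
    (hσ : Tendsto σ atTop (𝓝 s)) (hτ : Tendsto τ atTop (𝓝 t)) (hζ : Tendsto ζ atTop (𝓝 z)) :
    Tendsto (fun n => A (τ n) (ζ n) - A (σ n) (ζ n)) atTop (𝓝 (A t z - A s z)) := by
  rw [tendsto_iff_norm_sub_tendsto_zero]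
  have hz : Tendsto (fun n => M * (t - τ n) ^ α + M * (s - σ n) ^ α
      + M * (t - s) ^ α * ‖ζ n - z‖) atTop (𝓝 (M * (t - t) ^ α + M * (s - s) ^ α
      + M * (t - s) ^ α * ‖z - z‖)) :=
    ((((tendsto_const_nhds.sub hτ).rpow_const (Or.inr hα.le)).const_mul M).add
      (((tendsto_const_nhds.sub hσ).rpow_const (Or.inr hα.le)).const_mul M)).add
      ((hζ.sub_const z).norm.const_mul _)
  simp only [sub_self, Real.zero_rpow hα.ne', norm_zero, mul_zero, add_zero] at hz
  refine squeeze_zero (fun _ => norm_nonneg _) (fun n => ?_) hz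
  have h1 := hA.bound _ _ (ζ n) (hτ0 n) (hτt n) ht1
  have h2 := hA.bound _ _ (ζ n) (hσ0 n) (hσs n) (hst.trans ht1)
  have h3 := hA.lip _ _ (ζ n) z hs0 hst ht1
  have e : A (τ n) (ζ n) - A (σ n) (ζ n) - (A t z - A s z)
      = -(A t (ζ n) - A (τ n) (ζ n)) + (A s (ζ n) - A (σ n) (ζ n))
        + (A t (ζ n) - A s (ζ n) - (A t z - A s z)) := by abel
  rw [e]
  refine norm_add₃_le.trans ?_
  rw [norm_neg]
  exact add_le_add (add_le_add h1 h2) h3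

/-- Existence for a small field on the unit interval. -/
theorem IsYoungField.exists_solution_of_small {V : Type*} [NormedAddCommGroup V]
    [CompleteSpace V] {A : ℝ → V → V} {α β M : ℝ} (hA : IsYoungField A α β M 1) (hα : 0 < α)
    (hα1 : α < 1) (hβ : 0 < β) (hβ1 : β < 1) (hαβ : 1 < α * (1 + β))
    (hCM : 8 * (sewConst (α * (1 + β)) * M) ≤ 1) (x₀ : V) :
    ∃ x : ℝ → V, x 0 = x₀ ∧ ∀ s t : ℝ, 0 ≤ s → s ≤ t → t ≤ 1 →
      ‖x t - x s - (A t (x s) - A s (x s))‖ ≤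
        sewConst (α * (1 + β)) * M * (t - s) ^ (α * (1 + β)) := by
  set p := α * (1 + β) with hpdef
  have hM := hA.nonneg
  have hC := one_le_sewConst hαβ
  have hM1 : 8 * M ≤ 1 := by
    have : M ≤ sewConst p * M := le_mul_of_one_le_left hM hC
    linarith
  have hp2 : p ≤ 2 * α := by rw [hpdef]; nlinarith
  have hθ : 0 < 2 * α - p := by rw [hpdef]; nlinarith
  have hθα : 2 * α - p ≤ α := by rw [hpdef]; nlinarith
  let X : ℕ → ℕ → V := fun n => eulerScheme A ((1 / 2 : ℝ) ^ n) x₀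
  have hmesh : ∀ n : ℕ, (0 : ℝ) < (1 / 2) ^ n := fun n => by positivity
  have hgrid : ∀ n : ℕ, ((2 ^ n : ℕ) : ℝ) * (1 / 2) ^ n ≤ 1 := fun n => by
    push_cast
    rw [← mul_pow]
    norm_num
  have hchain : ∀ n : ℕ, IsEulerChain A ((1 / 2 : ℝ) ^ n) 0 p (2 ^ n) (X n) := fun n =>
    isEulerChain_eulerScheme A (hmesh n).le le_rfl p _ x₀
  have hholder : ∀ n i j : ℕ, i < j → j ≤ 2 ^ n →
      ‖X n j - X n i‖ ≤ (((j : ℝ) - i) * (1 / 2) ^ n) ^ α := fun n =>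
    (hchain n).holder hA hα hα1 (hmesh n) hαβ hp2 le_rfl hCM (by simp) (hgrid n)
  have hrem : ∀ n i j : ℕ, i < j → j ≤ 2 ^ n →
      ‖X n j - X n i - (A ((j : ℝ) * (1 / 2) ^ n) (X n i) - A ((i : ℝ) * (1 / 2) ^ n) (X n i))‖
        ≤ sewConst p * M * (((j : ℝ) - i) * (1 / 2) ^ n) ^ p := by
    intro n
    have := (hchain n).remainder_le hA hα (hmesh n) hαβ hp2 le_rfl zero_le_one (hgrid n)
      (by simpa using hholder n)
    simpa using this
  have hrefine : ∀ n k : ℕ, k ≤ 2 ^ n →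
      ‖X n k - X (n + 1) (2 * k)‖ ≤ ((1 / 2 : ℝ) ^ n) ^ (2 * α - p) := by
    intro n k hk
    have e : (2 : ℝ) * (1 / 2) ^ (n + 1) = (1 / 2) ^ n := by rw [pow_succ]; ring
    have hc := isEulerChain_eulerScheme_two_mul (p := p) hA hα (hmesh (n + 1)) (n := 2 ^ n)
      (by rw [e]; exact hgrid n) x₀
    rw [e] at hc
    set H := ((1 / 2 : ℝ) ^ n) ^ (2 * α - p) with hH
    have hH0 : 0 ≤ H := by positivity
    have hH1 : H ≤ 1 := Real.rpow_le_one (hmesh n).le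
      (pow_le_one₀ (by norm_num) (by norm_num)) hθ.le
    have hcm : sewConst p * (M ^ 2 * H) ≤ 1 / 64 * H := by
      calc sewConst p * (M ^ 2 * H) = sewConst p * M * M * H := by ring
        _ ≤ 1 / 8 * (1 / 8) * H := by gcongr <;> linarith
        _ = 1 / 64 * H := by ring
    have := IsEulerChain.norm_sub_le hA hα hα1 hβ hβ1 (hmesh n) hαβ le_rfl (by positivity) hCM
      (by linarith) (hgrid n)
      (isEulerChain_eulerScheme A (hmesh n).le (by positivity) p _ x₀) hc (by simp [eulerScheme])
      k hk
    refine this.trans ?_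
    linarith
  have hfl : ∀ t : ℝ, 0 ≤ t → t ≤ 1 → ∀ n : ℕ, ⌊t * 2 ^ n⌋₊ ≤ 2 ^ n := by
    intro t _ ht1 n
    apply Nat.floor_le_of_le
    push_cast
    nlinarith [pow_pos (two_pos : (0 : ℝ) < 2) n]
  have hlim : ∀ t : ℝ, ∃ l : V, 0 ≤ t → t ≤ 1 →
      Tendsto (fun n => X n ⌊t * 2 ^ n⌋₊) atTop (𝓝 l) := by
    intro t
    by_cases ht : 0 ≤ t ∧ t ≤ 1
    swap
    · exact ⟨0, fun h0 h1 => absurd ⟨h0, h1⟩ ht⟩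
    have hr1 : (1 / 2 : ℝ) ^ (2 * α - p) < 1 :=
      Real.rpow_lt_one (by norm_num) (by norm_num) hθ
    have hcau : CauchySeq (fun n => X n ⌊t * 2 ^ n⌋₊) := by
      refine cauchySeq_of_le_geometric _ 2 hr1 fun n => ?_
      have hpow : ((1 / 2 : ℝ) ^ (2 * α - p)) ^ n = ((1 / 2 : ℝ) ^ n) ^ (2 * α - p) := by
        rw [← Real.rpow_natCast, ← Real.rpow_natCast, ← Real.rpow_mul (by norm_num),
          ← Real.rpow_mul (by norm_num), mul_comm]
      rw [hpow, dist_eq_norm]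
      set k := ⌊t * 2 ^ n⌋₊ with hk
      set k' := ⌊t * 2 ^ (n + 1)⌋₊ with hk'
      have hdiv : k' / 2 = k := by
        have := Nat.floor_div_natCast (t * 2 ^ (n + 1)) 2
        rw [hk, hk', ← this, pow_succ]
        congr 1
        push_cast
        ring
      have hk2 : k ≤ 2 ^ n := hfl t ht.1 ht.2 n
      have hk2' : k' ≤ 2 ^ (n + 1) := hfl t ht.1 ht.2 (n + 1)
      have h1 := hrefine n k hk2
      have h2 : ‖X (n + 1) k' - X (n + 1) (2 * k)‖ ≤ ((1 / 2 : ℝ) ^ n) ^ (2 * α - p) := by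
        rcases (by omega : k' = 2 * k ∨ k' = 2 * k + 1) with h | h
        · rw [h, sub_self, norm_zero]
          positivity
        · have := hholder (n + 1) (2 * k) k' (by omega) hk2'
          refine this.trans ?_
          rw [h]
          push_cast
          rw [add_sub_cancel_left, one_mul]
          calc ((1 / 2 : ℝ) ^ (n + 1)) ^ α ≤ ((1 / 2 : ℝ) ^ n) ^ α := by
                refine Real.rpow_le_rpow (by positivity) ?_ hα.le
                exact pow_le_pow_of_le_one (by norm_num) (by norm_num) (by omega)
            _ ≤ _ := Real.rpow_le_rpow_of_exponent_ge (by positivity)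
                (pow_le_one₀ (by norm_num) (by norm_num)) hθα
      have e : X n k - X (n + 1) k' = (X n k - X (n + 1) (2 * k))
          - (X (n + 1) k' - X (n + 1) (2 * k)) := by abel
      rw [e]
      refine (norm_sub_le _ _).trans ?_
      linarith
    obtain ⟨l, hl⟩ := cauchySeq_tendsto_of_complete hcau
    exact ⟨l, fun _ _ => hl⟩
  choose x hx using hlim
  refine ⟨x, ?_, ?_⟩
  · refine tendsto_nhds_unique (hx 0 le_rfl zero_le_one) ?_
    simp [X, eulerScheme]
  · intro s t hs hst ht
    have h0t := hs.trans hst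
    have hs1 := hst.trans ht
    have hpow2 : ∀ n : ℕ, (2 : ℝ) ^ n * (1 / 2) ^ n = 1 := fun n => by
      rw [← mul_pow]; norm_num
    have hτle : ∀ r : ℝ, 0 ≤ r → ∀ n : ℕ, (⌊r * 2 ^ n⌋₊ : ℝ) * (1 / 2) ^ n ≤ r := by
      intro r hr n
      have := Nat.floor_le (by positivity : 0 ≤ r * 2 ^ n)
      calc (⌊r * 2 ^ n⌋₊ : ℝ) * (1 / 2) ^ n ≤ r * 2 ^ n * (1 / 2) ^ n := by gcongr
        _ = r := by rw [mul_assoc, hpow2, mul_one]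
    have hτlim : ∀ r : ℝ, 0 ≤ r →
        Tendsto (fun n : ℕ => (⌊r * 2 ^ n⌋₊ : ℝ) * (1 / 2) ^ n) atTop (𝓝 r) := by
      intro r hr
      have := (tendsto_nat_floor_mul_div_atTop hr).comp
        (tendsto_pow_atTop_atTop_of_one_lt (one_lt_two : (1 : ℝ) < 2))
      refine this.congr fun n => ?_
      simp [div_eq_mul_inv]
    have hG := ((hx t h0t ht).sub (hx s hs hs1)).sub
      (hA.tendsto_increment hα hs hst ht (fun n => by positivity) (hτle s hs)
        (fun n => by positivity) (hτle t h0t) (hτlim s hs) (hτlim t h0t) (hx s hs hs1))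
    have hB : Tendsto (fun n : ℕ => sewConst p * M * ((⌊t * 2 ^ n⌋₊ : ℝ) * (1 / 2) ^ n
        - (⌊s * 2 ^ n⌋₊ : ℝ) * (1 / 2) ^ n) ^ p) atTop (𝓝 (sewConst p * M * (t - s) ^ p)) :=
      (((hτlim t h0t).sub (hτlim s hs)).rpow_const (Or.inr (by linarith))).const_mul _
    refine le_of_tendsto_of_tendsto' hG.norm hB fun n => ?_
    have hle : ⌊s * 2 ^ n⌋₊ ≤ ⌊t * 2 ^ n⌋₊ := Nat.floor_le_floor (by gcongr)
    rw [← sub_mul]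
    rcases hle.eq_or_lt with h | h
    · simp [h, Real.zero_rpow (by linarith : p ≠ 0)]
    · exact hrem n _ _ h (hfl t h0t ht n)

/-- Uniqueness for a small field on the unit interval. -/
theorem IsYoungField.eq_of_small {V : Type*} [NormedAddCommGroup V] {A : ℝ → V → V}
    {α β M p ζ K : ℝ} (hA : IsYoungField A α β M 1) (hα : 0 < α) (hα1 : α < 1) (hβ : 0 < β)
    (hβ1 : β < 1) (hp : 1 < p) (hpα : p ≤ α * (1 + β)) (hpζ : p < ζ) (hK : 0 ≤ K)
    (hCM : 8 * (sewConst p * M) ≤ 1) {x y : ℝ → V}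
    (hx : ∀ s t : ℝ, 0 ≤ s → s ≤ t → t ≤ 1 →
      ‖x t - x s - (A t (x s) - A s (x s))‖ ≤ K * (t - s) ^ ζ)
    (hy : ∀ s t : ℝ, 0 ≤ s → s ≤ t → t ≤ 1 →
      ‖y t - y s - (A t (y s) - A s (y s))‖ ≤ K * (t - s) ^ ζ)
    (hxy : x 0 = y 0) {t : ℝ} (ht0 : 0 ≤ t) (ht1 : t ≤ 1) : x t = y t := by
  rcases ht0.eq_or_lt with rfl | htpos
  · exact hxy
  have hε : Tendsto (fun n : ℕ => K * (t / (n : ℝ)) ^ (ζ - p)) atTop (𝓝 0) := by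
    have := ((tendsto_const_div_atTop_nhds_zero_nat t).rpow_const
      (Or.inr (by linarith : 0 ≤ ζ - p))).const_mul K
    rwa [Real.zero_rpow (by linarith), mul_zero] at this
  have hsmall : ∀ᶠ n : ℕ in atTop, 4 * (sewConst p * (K * (t / (n : ℝ)) ^ (ζ - p))) ≤ 1 := by
    have h := (hε.const_mul (sewConst p)).const_mul 4
    rw [mul_zero, mul_zero] at h
    filter_upwards [h.eventually_lt_const one_pos] with n hn using hn.le
  have hchain : ∀ z : ℝ → V, (∀ s t : ℝ, 0 ≤ s → s ≤ t → t ≤ 1 →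
      ‖z t - z s - (A t (z s) - A s (z s))‖ ≤ K * (t - s) ^ ζ) → ∀ n : ℕ, 0 < n →
      IsEulerChain A (t / n) (K * (t / (n : ℝ)) ^ (ζ - p)) p n
        (fun k => z ((k : ℝ) * (t / n))) := by
    intro z hz n hn k hk
    have hn' : (0 : ℝ) < n := by exact_mod_cast hn
    have hk' : (((k + 1 : ℕ) : ℝ)) ≤ n := by exact_mod_cast hk
    have := hz (k * (t / n)) (((k + 1 : ℕ) : ℝ) * (t / n)) (by positivity)
      (by gcongr; omega)
      (calc ((k + 1 : ℕ) : ℝ) * (t / n) ≤ n * (t / n) := by gcongr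
        _ = t := by field_simp
        _ ≤ 1 := ht1)
    refine this.trans (le_of_eq ?_)
    rw [mul_assoc, ← Real.rpow_add (by positivity)]
    push_cast
    ring_nf
  have hbound : ∀ᶠ n : ℕ in atTop,
      ‖x t - y t‖ ≤ 8 * (sewConst p * (K * (t / (n : ℝ)) ^ (ζ - p))) := by
    filter_upwards [hsmall, eventually_gt_atTop 0] with n hn hn0
    have hn' : (0 : ℝ) < n := by exact_mod_cast hn0
    have e : (n : ℝ) * (t / n) = t := by field_simp
    have := IsEulerChain.norm_sub_le hA hα hα1 hβ hβ1 (by positivity) hp hpα (by positivity)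
      hCM hn (by rw [e]; exact ht1) (hchain x hx n hn0) (hchain y hy n hn0) (by simp [hxy])
      n le_rfl
    simpa only [e] using this
  have hlim := (hε.const_mul (sewConst p)).const_mul 8
  rw [mul_zero, mul_zero] at hlim
  have := ge_of_tendsto hlim hbound
  exact sub_eq_zero.1 (norm_le_zero_iff.1 this)

theorem rpow_le_mul_rpow_of_le {r T e ζ : ℝ} (hr : 0 ≤ r) (hrT : r ≤ T) (hζ : 0 ≤ ζ)
    (hζe : ζ ≤ e) : r ^ e ≤ T ^ (e - ζ) * r ^ ζ := by
  have h : r ^ e = r ^ (e - ζ) * r ^ ζ := by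
    rw [← Real.rpow_add_of_nonneg hr (by linarith) hζ, sub_add_cancel]
  rw [h]
  gcongr

theorem exists_subdivision_small {α c T : ℝ} (hα : 0 < α) :
    ∃ m : ℕ, 0 < m ∧ c * (T / m) ^ α ≤ 1 := by
  have h := ((tendsto_const_div_atTop_nhds_zero_nat T).rpow_const
    (Or.inr hα.le)).const_mul c
  rw [Real.zero_rpow hα.ne', mul_zero] at h
  obtain ⟨m, hm0, hm⟩ := ((eventually_gt_atTop 0).and (h.eventually_lt_const one_pos)).exists
  exact ⟨m, hm0, hm.le⟩

/-- Existence on a short interval `[a, a + l]`. -/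
theorem IsYoungField.exists_solution_on_short {V : Type*} [NormedAddCommGroup V]
    [CompleteSpace V] {A : ℝ → V → V} {α β M T a l : ℝ} (hA : IsYoungField A α β M T)
    (hα : 0 < α) (hα1 : α < 1) (hβ : 0 < β) (hβ1 : β < 1) (hαβ : 1 < α * (1 + β)) (ha : 0 ≤ a)
    (hl : 0 < l) (hal : a + l ≤ T)
    (hCM : 8 * (sewConst (α * (1 + β)) * (M * l ^ α)) ≤ 1) (x₀ : V) :
    ∃ (x : ℝ → V) (K : ℝ), 0 ≤ K ∧ x a = x₀ ∧ ∀ s t : ℝ, a ≤ s → s ≤ t → t ≤ a + l →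
      ‖x t - x s - (A t (x s) - A s (x s))‖ ≤ K * (t - s) ^ (α * (1 + β)) := by
  have hC := one_le_sewConst hαβ
  have hB := hA.rescale ha hl.le hal
  obtain ⟨X, hX0, hX⟩ := hB.exists_solution_of_small hα hα1 hβ hβ1 hαβ hCM x₀
  have hK : 0 ≤ sewConst (α * (1 + β)) * (M * l ^ α) :=
    mul_nonneg (by linarith) hB.nonneg
  refine ⟨fun t => X ((t - a) / l), sewConst (α * (1 + β)) * (M * l ^ α) / l ^ (α * (1 + β)),
    by positivity, by simpa using hX0, ?_⟩
  intro s t hs hst ht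
  have := hX ((s - a) / l) ((t - a) / l) (div_nonneg (by linarith) hl.le) (by gcongr)
    ((div_le_one hl).2 (by linarith))
  rw [mul_div_cancel₀ _ hl.ne', mul_div_cancel₀ _ hl.ne', add_sub_cancel, add_sub_cancel,
    ← sub_div, sub_sub_sub_cancel_right, Real.div_rpow (by linarith) hl.le] at this
  refine this.trans (le_of_eq ?_)
  ring

/-- A solution on `[0, a]` and a solution on `[a, b]` which agree at `a` glue together. -/
theorem IsYoungField.glue {V : Type*} [NormedAddCommGroup V] {A : ℝ → V → V}
    {α β M T a b p K₁ K₂ : ℝ} (hA : IsYoungField A α β M T) (hα : 0 < α) (hαp : α ≤ p)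
    (hp2 : p ≤ 2 * α) (ha : 0 ≤ a) (hab : a ≤ b) (hb : b ≤ T) (hK₁ : 0 ≤ K₁) (hK₂ : 0 ≤ K₂)
    {x y : ℝ → V}
    (hx : ∀ s t : ℝ, 0 ≤ s → s ≤ t → t ≤ a →
      ‖x t - x s - (A t (x s) - A s (x s))‖ ≤ K₁ * (t - s) ^ p)
    (hy : ∀ s t : ℝ, a ≤ s → s ≤ t → t ≤ b →
      ‖y t - y s - (A t (y s) - A s (y s))‖ ≤ K₂ * (t - s) ^ p) (hxy : y a = x a) :
    ∃ (z : ℝ → V) (K : ℝ), 0 ≤ K ∧ z 0 = x 0 ∧ ∀ s t : ℝ, 0 ≤ s → s ≤ t → t ≤ b →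
      ‖z t - z s - (A t (z s) - A s (z s))‖ ≤ K * (t - s) ^ p := by
  have hM := hA.nonneg
  have hp0 : 0 ≤ p := hα.le.trans hαp
  have hT : 0 ≤ T := ha.trans (hab.trans hb)
  set L := M + K₁ * T ^ (p - α) with hL
  have hL0 : 0 ≤ L := by positivity
  set D := M * L * T ^ (2 * α - p) with hD
  have hD0 : 0 ≤ D := by positivity
  refine ⟨fun t => if t ≤ a then x t else y t, K₁ + K₂ + D, by positivity, by simp [ha], ?_⟩
  intro s t hs hst ht
  have hts : 0 ≤ t - s := by linarith
  have hw : 0 ≤ (t - s) ^ p := by positivity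
  rcases le_or_gt t a with hta | hta
  · simp only [hta, hst.trans hta, if_true]
    refine (hx s t hs hst hta).trans ?_
    gcongr
    linarith
  rcases le_or_gt s a with hsa | hsa
  · simp only [hta.not_ge, hsa, if_true, if_false]
    have h1 := hx s a hs hsa le_rfl
    have h2 := hy a t le_rfl hta.le ht
    have h3 := hA.lip a t (x a) (x s) ha hta.le (ht.trans hb)
    have h4 : ‖x a - x s‖ ≤ L * (t - s) ^ α := by
      have hb' := hA.bound s a (x s) hs hsa (hab.trans hb)
      calc ‖x a - x s‖ ≤ ‖x a - x s - (A a (x s) - A s (x s))‖ + ‖A a (x s) - A s (x s)‖ :=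
            norm_le_norm_sub_add _ _
        _ ≤ K₁ * (T ^ (p - α) * (a - s) ^ α) + M * (a - s) ^ α := by
          refine add_le_add (h1.trans ?_) hb'
          gcongr
          exact rpow_le_mul_rpow_of_le (by linarith) (by linarith) hα.le hαp
        _ = L * (a - s) ^ α := by rw [hL]; ring
        _ ≤ L * (t - s) ^ α := by
          gcongr
    have h5 : ‖A t (x a) - A a (x a) - (A t (x s) - A a (x s))‖ ≤ D * (t - s) ^ p := by
      calc _ ≤ M * (t - a) ^ α * ‖x a - x s‖ := h3
        _ ≤ M * (t - s) ^ α * (L * (t - s) ^ α) := by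
          gcongr
        _ = M * L * (t - s) ^ (2 * α) := by
          rw [two_mul, Real.rpow_add_of_nonneg hts hα.le hα.le]
          ring
        _ ≤ M * L * (T ^ (2 * α - p) * (t - s) ^ p) := by
          gcongr
          exact rpow_le_mul_rpow_of_le hts (by linarith) (by linarith) hp2
        _ = D * (t - s) ^ p := by rw [hD]; ring
    rw [hxy] at h2
    have e : y t - x s - (A t (x s) - A s (x s))
        = (x a - x s - (A a (x s) - A s (x s))) + (y t - x a - (A t (x a) - A a (x a)))
          + (A t (x a) - A a (x a) - (A t (x s) - A a (x s))) := by abel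
    rw [e, add_mul, add_mul]
    refine norm_add₃_le.trans (add_le_add (add_le_add (h1.trans ?_) (h2.trans ?_)) h5)
    · gcongr
    · gcongr
  · simp only [hta.not_ge, hsa.not_ge, if_false]
    refine (hy s t hsa.le hst ht).trans ?_
    gcongr
    linarith

/-- Global existence. -/
theorem IsYoungField.exists_solution {V : Type*} [NormedAddCommGroup V] [CompleteSpace V]
    {A : ℝ → V → V} {α β M T : ℝ} (hA : IsYoungField A α β M T) (hα : 0 < α) (hα1 : α < 1)
    (hβ : 0 < β) (hβ1 : β < 1) (hαβ : 1 < α * (1 + β)) (hT : 0 < T) (x₀ : V) :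
    ∃ (x : ℝ → V) (K : ℝ), 0 ≤ K ∧ x 0 = x₀ ∧ ∀ s t : ℝ, 0 ≤ s → s ≤ t → t ≤ T →
      ‖x t - x s - (A t (x s) - A s (x s))‖ ≤ K * (t - s) ^ (α * (1 + β)) := by
  obtain ⟨m, hm0, hm⟩ :=
    exists_subdivision_small (c := 8 * (sewConst (α * (1 + β)) * M)) (T := T) hα
  have hm' : (0 : ℝ) < m := by exact_mod_cast hm0
  have hmT : (m : ℝ) * (T / m) = T := by field_simp
  suffices H : ∀ k : ℕ, k ≤ m → ∃ (x : ℝ → V) (K : ℝ), 0 ≤ K ∧ x 0 = x₀ ∧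
      ∀ s t : ℝ, 0 ≤ s → s ≤ t → t ≤ k * (T / m) →
      ‖x t - x s - (A t (x s) - A s (x s))‖ ≤ K * (t - s) ^ (α * (1 + β)) by
    simpa only [hmT] using H m le_rfl
  intro k
  induction k with
  | zero =>
    intro _
    refine ⟨fun _ => x₀, 0, le_rfl, rfl, ?_⟩
    intro s t hs hst ht
    rw [Nat.cast_zero, zero_mul] at ht
    obtain rfl : s = t := by linarith
    simp
  | succ k ih =>
    intro hk
    obtain ⟨x, K, hK, hx0, hx⟩ := ih (by omega)
    have hkm : ((k + 1 : ℕ) : ℝ) ≤ m := by exact_mod_cast hk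
    have hsucc : ((k + 1 : ℕ) : ℝ) * (T / m) = k * (T / m) + T / m := by push_cast; ring
    have hle : k * (T / m) + T / m ≤ T := by
      rw [← hsucc]
      exact (mul_le_mul_of_nonneg_right hkm (by positivity)).trans hmT.le
    obtain ⟨y, K', hK', hy0, hy⟩ := hA.exists_solution_on_short hα hα1 hβ hβ1 hαβ
      (a := k * (T / m)) (l := T / m) (by positivity) (by positivity) hle
      (le_trans (le_of_eq (by ring)) hm) (x (k * (T / m)))
    rw [hsucc, ← hx0]
    exact hA.glue hα (by nlinarith) (by nlinarith) (by positivity)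
      (le_add_of_nonneg_right (by positivity)) hle hK hK' hx hy hy0

/-- Global uniqueness for paths whose germ remainder has an exponent larger than one. -/
theorem IsYoungField.eq_of_remainder_le {V : Type*} [NormedAddCommGroup V] {A : ℝ → V → V}
    {α β M T ζ K : ℝ} (hA : IsYoungField A α β M T) (hα : 0 < α) (hα1 : α < 1) (hβ : 0 < β)
    (hβ1 : β < 1) (hζ : 1 < ζ) (hζα : ζ ≤ α * (1 + β)) (hT : 0 < T) (hK : 0 ≤ K) {x y : ℝ → V}
    (hx : ∀ s t : ℝ, 0 ≤ s → s ≤ t → t ≤ T →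
      ‖x t - x s - (A t (x s) - A s (x s))‖ ≤ K * (t - s) ^ ζ)
    (hy : ∀ s t : ℝ, 0 ≤ s → s ≤ t → t ≤ T →
      ‖y t - y s - (A t (y s) - A s (y s))‖ ≤ K * (t - s) ^ ζ)
    (hxy : x 0 = y 0) {t : ℝ} (ht0 : 0 ≤ t) (ht : t ≤ T) : x t = y t := by
  obtain ⟨p, hp, hpζ⟩ := exists_between hζ
  obtain ⟨m, hm0, hm⟩ := exists_subdivision_small (c := 8 * (sewConst p * M)) (T := T) hα
  have hm' : (0 : ℝ) < m := by exact_mod_cast hm0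
  have hmT : (m : ℝ) * (T / m) = T := by field_simp
  suffices H : ∀ k : ℕ, k ≤ m → ∀ t : ℝ, 0 ≤ t → t ≤ k * (T / m) → x t = y t by
    exact H m le_rfl t ht0 (ht.trans hmT.ge)
  intro k
  induction k with
  | zero =>
    intro _ t h0 h1
    rw [Nat.cast_zero, zero_mul] at h1
    obtain rfl : t = 0 := le_antisymm h1 h0
    exact hxy
  | succ k ih =>
    intro hk t h0 h1
    rcases le_or_gt t (k * (T / m)) with htk | htk
    · exact ih (by omega) t h0 htk
    have hkm : ((k + 1 : ℕ) : ℝ) ≤ m := by exact_mod_cast hk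
    have hsucc : ((k + 1 : ℕ) : ℝ) * (T / m) = k * (T / m) + T / m := by push_cast; ring
    have hle : k * (T / m) + T / m ≤ T := by
      rw [← hsucc]
      exact (mul_le_mul_of_nonneg_right hkm (by positivity)).trans hmT.le
    rw [hsucc] at h1
    set a := k * (T / m) with ha
    set l := T / m with hl
    have hl0 : 0 < l := by positivity
    have ha0 : 0 ≤ a := by positivity
    have hres : ∀ z : ℝ → V, (∀ s t : ℝ, 0 ≤ s → s ≤ t → t ≤ T →
        ‖z t - z s - (A t (z s) - A s (z s))‖ ≤ K * (t - s) ^ ζ) →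
        ∀ s t : ℝ, 0 ≤ s → s ≤ t → t ≤ 1 →
          ‖z (a + l * t) - z (a + l * s) - (A (a + l * t) (z (a + l * s))
            - A (a + l * s) (z (a + l * s)))‖ ≤ K * l ^ ζ * (t - s) ^ ζ := by
      intro z hz s t hs hst ht
      refine (hz (a + l * s) (a + l * t) (by positivity) (by gcongr) (by nlinarith)).trans
        (le_of_eq ?_)
      rw [show a + l * t - (a + l * s) = l * (t - s) by ring,
        Real.mul_rpow hl0.le (by linarith)]
      ring
    have := (hA.rescale ha0 hl0.le hle).eq_of_small hα hα1 hβ hβ1 hp (hpζ.le.trans hζα) hpζ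
      (K := K * l ^ ζ) (by positivity) (le_trans (le_of_eq (by ring)) hm)
      (x := fun r => x (a + l * r)) (y := fun r => y (a + l * r)) (hres x hx) (hres y hy)
      (by simpa using ih (by omega) a ha0 le_rfl) (t := (t - a) / l)
      (div_nonneg (by linarith) hl0.le) ((div_le_one hl0).2 (by linarith))
    simpa only [mul_div_cancel₀ _ hl0.ne', add_sub_cancel] using this


/-- **Global well-posedness of nonlinear YDEs with `C^{1+β}` drift.**  Let `α(1+β) > 1` and
`A ∈ C^α_t C^{1+β}_V`.  For every `x₀ ∈ V` there is exactly one solution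
`x ∈ C^α([0,T];V)` of `x_t = x₀ + ∫_0^t A(ds,x_s)`; moreover, for every `γ ∈ (0,1)` with
`α + βγ > 1`, every `γ`-Hölder solution starting at `x₀` coincides with `x`. -/
theorem yde_global_wellposedness
    {V : Type*} [NormedAddCommGroup V] [NormedSpace ℝ V] [CompleteSpace V]
    (α β : ℝ) (hα0 : 0 < α) (hα1 : α < 1) (hβ0 : 0 < β) (hβ1 : β < 1)
    (hαβ : 1 < α * (1 + β)) (T : ℝ) (hT : 0 < T)
    (A : ℝ → V → V) (DA : ℝ → V → (V →L[ℝ] V)) (MA : ℝ)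
    (hA0 : ∀ z : V, A 0 z = 0)
    (hderiv : ∀ t : ℝ, ∀ z : V, 0 ≤ t → t ≤ T → HasFDerivAt (A t) (DA t z) z)
    (hAbd : ∀ s t : ℝ, ∀ z : V, 0 ≤ s → s ≤ t → t ≤ T →
      ‖A t z - A s z‖ ≤ MA * (t - s) ^ α)
    (hAhol : ∀ s t : ℝ, ∀ z w : V, 0 ≤ s → s ≤ t → t ≤ T →
      ‖A t z - A s z - (A t w - A s w)‖ ≤ MA * (t - s) ^ α * ‖z - w‖ ^ β)
    (hDAbd : ∀ s t : ℝ, ∀ z : V, 0 ≤ s → s ≤ t → t ≤ T →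
      ‖DA t z - DA s z‖ ≤ MA * (t - s) ^ α)
    (hDAhol : ∀ s t : ℝ, ∀ z w : V, 0 ≤ s → s ≤ t → t ≤ T →
      ‖DA t z - DA s z - (DA t w - DA s w)‖ ≤ MA * (t - s) ^ α * ‖z - w‖ ^ β) :
    ∀ x₀ : V, ∃ x : ℝ → V,
      x 0 = x₀ ∧
      (∃ Kx : ℝ, ∀ s t : ℝ, 0 ≤ s → s ≤ t → t ≤ T → ‖x t - x s‖ ≤ Kx * (t - s) ^ α) ∧
      (∃ K : ℝ, ∀ s t : ℝ, 0 ≤ s → s ≤ t → t ≤ T →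
        ‖x t - x s - (A t (x s) - A s (x s))‖ ≤ K * (t - s) ^ (α * (1 + β))) ∧
      (∀ (y : ℝ → V) (Ky K' : ℝ), y 0 = x₀ →
        (∀ s t : ℝ, 0 ≤ s → s ≤ t → t ≤ T → ‖y t - y s‖ ≤ Ky * (t - s) ^ α) →
        (∀ s t : ℝ, 0 ≤ s → s ≤ t → t ≤ T →
          ‖y t - y s - (A t (y s) - A s (y s))‖ ≤ K' * (t - s) ^ (α * (1 + β))) →
        ∀ t : ℝ, 0 ≤ t → t ≤ T → y t = x t) ∧
      (∀ γ : ℝ, 0 < γ → γ < 1 → 1 < α + β * γ →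
        ∀ (y : ℝ → V) (Ky K' : ℝ), y 0 = x₀ →
          (∀ s t : ℝ, 0 ≤ s → s ≤ t → t ≤ T → ‖y t - y s‖ ≤ Ky * (t - s) ^ γ) →
          (∀ s t : ℝ, 0 ≤ s → s ≤ t → t ≤ T →
            ‖y t - y s - (A t (y s) - A s (y s))‖ ≤ K' * (t - s) ^ (α + β * γ)) →
          ∀ t : ℝ, 0 ≤ t → t ≤ T → y t = x t) := by
  have hMA : 0 ≤ MA := by
    have h := (norm_nonneg _).trans (hAbd 0 T 0 le_rfl hT.le le_rfl)
    exact nonneg_of_mul_nonneg_left h (Real.rpow_pos_of_pos (by linarith) _)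
  have hinc : ∀ s t : ℝ, 0 ≤ s → s ≤ t → t ≤ T → ∀ z : V,
      HasFDerivAt (fun z => A t z - A s z) (DA t z - DA s z) z := fun s t hs hst ht z =>
    (hderiv t z (hs.trans hst) ht).sub (hderiv s z hs (hst.trans ht))
  have hA : IsYoungField A α β MA T := by
    refine ⟨hMA, hAbd, ?_, ?_⟩
    · intro s t z w hs hst ht
      exact convex_univ.norm_image_sub_le_of_norm_hasFDerivWithin_le
        (fun v _ => (hinc s t hs hst ht v).hasFDerivWithinAt)
        (fun v _ => hDAbd s t v hs hst ht) (Set.mem_univ w) (Set.mem_univ z)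
    · intro s t x y x' y' hs hst ht
      exact norm_four_point_le hβ0.le (hinc s t hs hst ht) (fun z => hDAbd s t z hs hst ht)
        (fun z w => hDAhol s t z w hs hst ht) x y x' y'
  intro x₀
  obtain ⟨x, K, hK, hx0, hx⟩ := hA.exists_solution hα0 hα1 hβ0 hβ1 hαβ hT x₀
  have huniq : ∀ γ : ℝ, 1 < α + β * γ → ∀ (y : ℝ → V) (K' : ℝ), y 0 = x₀ →
      (∀ s t : ℝ, 0 ≤ s → s ≤ t → t ≤ T →
        ‖y t - y s - (A t (y s) - A s (y s))‖ ≤ K' * (t - s) ^ (α + β * γ)) →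
      ∀ t : ℝ, 0 ≤ t → t ≤ T → y t = x t := by
    intro γ hγ y K' hy0 hy t ht0 ht
    set ζ := min (α * (1 + β)) (α + β * γ) with hζdef
    have hζ : 1 < ζ := lt_min hαβ hγ
    have hweak : ∀ (z : ℝ → V) (c e : ℝ), ζ ≤ e → (∀ s t : ℝ, 0 ≤ s → s ≤ t → t ≤ T →
        ‖z t - z s - (A t (z s) - A s (z s))‖ ≤ c * (t - s) ^ e) →
        ∀ s t : ℝ, 0 ≤ s → s ≤ t → t ≤ T →
          ‖z t - z s - (A t (z s) - A s (z s))‖ ≤ |c| * T ^ (e - ζ) * (t - s) ^ ζ := by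
      intro z c e he hz s t hs hst ht
      have hts : 0 ≤ t - s := by linarith
      calc _ ≤ c * (t - s) ^ e := hz s t hs hst ht
        _ ≤ |c| * (T ^ (e - ζ) * (t - s) ^ ζ) := by
          gcongr
          · exact le_abs_self c
          · exact rpow_le_mul_rpow_of_le hts (by linarith) (by linarith) he
        _ = _ := by ring
    have h1 := hweak x K _ (min_le_left _ _) hx
    have h2 := hweak y K' _ (min_le_right _ _) hy
    refine hA.eq_of_remainder_le hα0 hα1 hβ0 hβ1 hζ (min_le_left _ _) hT
      (K := |K| * T ^ (α * (1 + β) - ζ) + |K'| * T ^ (α + β * γ - ζ)) (by positivity) ?_ ?_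
      (hy0.trans hx0.symm) ht0 ht
    · intro s t hs hst ht
      have hts : 0 ≤ t - s := by linarith
      refine (h2 s t hs hst ht).trans ?_
      gcongr
      exact le_add_of_nonneg_left (by positivity)
    · intro s t hs hst ht
      have hts : 0 ≤ t - s := by linarith
      refine (h1 s t hs hst ht).trans ?_
      gcongr
      exact le_add_of_nonneg_right (by positivity)
  refine ⟨x, hx0, ⟨K * T ^ (α * (1 + β) - α) + MA, ?_⟩, ⟨K, hx⟩, ?_, ?_⟩
  · intro s t hs hst ht
    calc ‖x t - x s‖ ≤ ‖x t - x s - (A t (x s) - A s (x s))‖ + ‖A t (x s) - A s (x s)‖ :=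
          norm_le_norm_sub_add _ _
      _ ≤ K * (T ^ (α * (1 + β) - α) * (t - s) ^ α) + MA * (t - s) ^ α := by
        refine add_le_add ((hx s t hs hst ht).trans ?_) (hAbd s t _ hs hst ht)
        gcongr
        exact rpow_le_mul_rpow_of_le (by linarith) (by linarith) hα0.le (by linarith)
      _ = _ := by ring
  · intro y _ K' hy0 _ hy
    rw [show α * (1 + β) = α + β * α by ring] at hαβ hy
    exact huniq α hαβ y K' hy0 hy
  · intro γ _ _ hγ y _ K' hy0 _ hy
    exact huniq γ hγ y K' hy0 hy
end

section
/- Comparison principle for nonlinear YDEs: Let α, β ∈ (0,1) with α(1+β) > 1, λ ∈ (0,1] with β + λ ≤ 1, and R, M > 0. For i = 1, 2 let x₀^i ∈ V with ‖x₀^i‖_V ≤ R, let A^i ∈ C^α_t C^{β,λ}_V with ‖A^i‖_{α,β,λ} ≤ M, assume moreover A¹ admits a spatial Fréchet differential DA¹ with ‖A¹‖_{α,1+β,λ} := ‖A¹‖_{α,β,λ} + ‖DA¹‖_{α,β,λ} ≤ M, and let x^i ∈ C^α([0,T];V) be solutions of the YDEs x^i_t = x₀^i + ∫_0^t A^i(ds,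 x^i_s) (in the sense that the localized sewing bound in the definition of solution holds). Then there exists a constant C = C(α,β,T,R,M), increasing in R and M, such that ⟦x¹ − x²⟧_α ≤ C (‖x₀¹ − x₀²‖_V + ‖A¹ − A²‖_{α,β,λ}). -/
/-- The `γ`-Hölder seminorm of a path on a subinterval `[a,b]`. -/
noncomputable def holderSemiBetween {V : Type*} [NormedAddCommGroup V]
    (γ a b : ℝ) (x : ℝ → V) : ℝ :=
  sSup {r : ℝ | ∃ s t : ℝ, a ≤ s ∧ s < t ∧ t ≤ b ∧ r = ‖x t - x s‖ / (t - s) ^ γ}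

/-- The supremum of `‖x‖` over a subinterval `[a,b]`. -/
noncomputable def supNormBetween {V : Type*} [NormedAddCommGroup V]
    (a b : ℝ) (x : ℝ → V) : ℝ :=
  sSup {r : ℝ | ∃ t : ℝ, a ≤ t ∧ t ≤ b ∧ r = ‖x t‖}

/-- `z` is `α`-Hölder on `[a,b]` with constant `H`. -/
def HolderBoundOn {V : Type*} [NormedAddCommGroup V] (α a b : ℝ) (z : ℝ → V) (H : ℝ) : Prop :=
  ∀ s t : ℝ, a ≤ s → s ≤ t → t ≤ b → ‖z t - z s‖ ≤ H * (t - s) ^ α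

/-- The norm bound `‖A‖_{α,β,λ} ≤ M` on `[0,T]`. -/
structure DriftBound {V W : Type*} [NormedAddCommGroup V] [NormedAddCommGroup W]
    (α β lam T M : ℝ) (A : ℝ → V → W) : Prop where
  zero : ∀ s t : ℝ, 0 ≤ s → s ≤ t → t ≤ T → ‖A t 0 - A s 0‖ ≤ M * (t - s) ^ α
  holder : ∀ s t : ℝ, 0 ≤ s → s ≤ t → t ≤ T → ∀ R : ℝ, 1 ≤ R → ∀ z w : V,
    ‖z‖ ≤ R → ‖w‖ ≤ R →
      ‖A t z - A s z - (A t w - A s w)‖ ≤ M * R ^ lam * (t - s) ^ α * ‖z - w‖ ^ β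

/-- `x` is an `α`-Hölder path whose increments agree with those of `A(ds, x_s)` up to a
remainder of order `α(1+β)`. -/
structure YoungSolution {V : Type*} [NormedAddCommGroup V]
    (α β T : ℝ) (A : ℝ → V → V) (x : ℝ → V) : Prop where
  holder : ∃ K : ℝ, HolderBoundOn α 0 T x K
  remainder : ∃ κ : ℝ, 0 ≤ κ ∧ ∀ s t : ℝ, 0 ≤ s → s ≤ t → t ≤ T →
    ‖x t - x s - (A t (x s) - A s (x s))‖ ≤ κ * (t - s) ^ (α * (1 + β))

/-- A bound that improves affinely with ratio `q < 1` holds with the fixed point as constant. -/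
theorem le_fixedPoint_mul_of_contraction {ι : Type*} (S : Set ι) (f w : ι → ℝ)
    {q B K : ℝ} (hq0 : 0 ≤ q) (hq1 : q < 1) (hB : 0 ≤ B) (hK : 0 ≤ K)
    (h₀ : ∀ i ∈ S, f i ≤ K * w i)
    (hstep : ∀ K' : ℝ, 0 ≤ K' → (∀ i ∈ S, f i ≤ K' * w i) →
      ∀ i ∈ S, f i ≤ (q * K' + B) * w i) :
    ∀ i ∈ S, f i ≤ B / (1 - q) * w i := by
  have hq : 0 < 1 - q := by linarith
  have hF : 0 ≤ B / (1 - q) := by positivity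
  have hiter : ∀ k : ℕ, ∀ i ∈ S, f i ≤ (B / (1 - q) + q ^ k * (K - B / (1 - q))) * w i ∧
      0 ≤ B / (1 - q) + q ^ k * (K - B / (1 - q)) := by
    intro k
    induction k with
    | zero => exact fun i hi => by simpa using ⟨h₀ i hi, hK⟩
    | succ k ih =>
      intro i hi
      have h2 : q * (B / (1 - q) + q ^ k * (K - B / (1 - q))) + B =
          B / (1 - q) + q ^ (k + 1) * (K - B / (1 - q)) := by
        field_simp; ring
      have h3 := hstep _ (ih i hi).2 fun j hj => (ih j hj).1
      rw [h2] at h3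
      refine ⟨h3 i hi, ?_⟩
      rw [← h2]
      have := (ih i hi).2
      positivity
  intro i hi
  have hlim : Filter.Tendsto
      (fun k : ℕ => (B / (1 - q) + q ^ k * (K - B / (1 - q))) * w i) Filter.atTop
      (nhds ((B / (1 - q) + 0 * (K - B / (1 - q))) * w i)) :=
    (((tendsto_pow_atTop_nhds_zero_of_lt_one hq0 hq1).mul_const _).const_add _).mul_const _
  simpa using ge_of_tendsto' hlim fun k => (hiter k i hi).1

/-- Sewing estimate: an a priori remainder of order `γ > 1` is controlled by the defect of
additivity of the germ at midpoints. -/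
theorem sewing_remainder_le {V : Type*} [NormedAddCommGroup V] {γ : ℝ} (hγ : 1 < γ)
    {a b K B : ℝ} (hK : 0 ≤ K) (hB : 0 ≤ B) (x : ℝ → V) (Ξ : ℝ → ℝ → V)
    (hrem : ∀ s t : ℝ, a ≤ s → s ≤ t → t ≤ b → ‖x t - x s - Ξ s t‖ ≤ K * (t - s) ^ γ)
    (hdef : ∀ s u t : ℝ, a ≤ s → s ≤ u → u ≤ t → t ≤ b →
      ‖Ξ s t - Ξ s u - Ξ u t‖ ≤ B * (t - s) ^ γ) :
    ∀ s t : ℝ, a ≤ s → s ≤ t → t ≤ b →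
      ‖x t - x s - Ξ s t‖ ≤ B / (1 - 2 ^ (1 - γ)) * (t - s) ^ γ := by
  have hq1 : (2 : ℝ) ^ (1 - γ) < 1 := Real.rpow_lt_one_of_one_lt_of_neg (by norm_num) (by linarith)
  have key := le_fixedPoint_mul_of_contraction {p : ℝ × ℝ | a ≤ p.1 ∧ p.1 ≤ p.2 ∧ p.2 ≤ b}
    (fun p => ‖x p.2 - x p.1 - Ξ p.1 p.2‖) (fun p => (p.2 - p.1) ^ γ)
    (q := 2 ^ (1 - γ)) (by positivity) hq1 hB hK
    (fun p hp => hrem p.1 p.2 hp.1 hp.2.1 hp.2.2) ?_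
  · exact fun s t hs hst ht => key (s, t) ⟨hs, hst, ht⟩
  rintro K' - hK' ⟨s, t⟩ ⟨hs, hst, ht⟩
  dsimp only at hs hst ht ⊢
  have h1 := hK' (s, (s + t) / 2) ⟨hs, by dsimp only; linarith, by dsimp only; linarith⟩
  have h2 := hK' ((s + t) / 2, t) ⟨by dsimp only; linarith, by dsimp only; linarith, ht⟩
  dsimp only at h1 h2
  have h3 := hdef s ((s + t) / 2) t hs (by linarith) (by linarith) ht
  rw [show (s + t) / 2 - s = (t - s) / 2 by ring] at h1
  rw [show t - (s + t) / 2 = (t - s) / 2 by ring] at h2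
  have h4 : 2 * ((t - s) / 2) ^ γ = 2 ^ (1 - γ) * (t - s) ^ γ := by
    rw [Real.div_rpow (by linarith) (by norm_num), Real.rpow_sub (by norm_num), Real.rpow_one]
    ring
  have h5 : x t - x s - Ξ s t = (x ((s + t) / 2) - x s - Ξ s ((s + t) / 2)) +
      (x t - x ((s + t) / 2) - Ξ ((s + t) / 2) t) -
      (Ξ s t - Ξ s ((s + t) / 2) - Ξ ((s + t) / 2) t) := by abel
  calc ‖x t - x s - Ξ s t‖ ≤ K' * ((t - s) / 2) ^ γ + K' * ((t - s) / 2) ^ γ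
        + B * (t - s) ^ γ := by
        rw [h5]
        exact (norm_sub_le _ _).trans (add_le_add ((norm_add_le _ _).trans (add_le_add h1 h2)) h3)
    _ = (2 ^ (1 - γ) * K' + B) * (t - s) ^ γ := by linear_combination K' * h4

theorem HolderBoundOn.norm_le {V : Type*} [NormedAddCommGroup V] {α a b H : ℝ} {z : ℝ → V}
    (hz : HolderBoundOn α a b z H) (hα : 0 ≤ α) (hH : 0 ≤ H) {s : ℝ} (has : a ≤ s) (hsb : s ≤ b) :
    ‖z s‖ ≤ ‖z a‖ + H * (b - a) ^ α := by
  have h1 := hz a s le_rfl has hsb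
  have h2 : (s - a) ^ α ≤ (b - a) ^ α :=
    Real.rpow_le_rpow (by linarith) (by linarith) hα
  have h3 := norm_le_norm_add_norm_sub' (z s) (z a)
  nlinarith [mul_le_mul_of_nonneg_left h2 hH]

/-- A path whose Hölder constant on short intervals is controlled by itself times a power of
the length, plus its initial value and an inhomogeneity, is controlled on `[0,T]`. -/
theorem exists_holderBoundOn_of_selfBound {α T E : ℝ} (hα : 0 < α) (hT : 0 < T) (hE : 0 < E) :
    ∃ C : ℝ, 0 ≤ C ∧ ∀ {V : Type*} [NormedAddCommGroup V] (z : ℝ → V) (e : ℝ), 0 ≤ e →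
      (∃ K : ℝ, HolderBoundOn α 0 T z K) →
      (∀ s t : ℝ, 0 ≤ s → s ≤ t → t ≤ T → t - s ≤ 1 → ∀ H : ℝ, 0 ≤ H →
        HolderBoundOn α s t z H →
        ‖z t - z s‖ ≤ E * (‖z s‖ + e + H * (t - s) ^ α) * (t - s) ^ α) →
      HolderBoundOn α 0 T z (C * (‖z 0‖ + e)) ∧
        ∀ t : ℝ, 0 ≤ t → t ≤ T → ‖z t‖ + e ≤ C * (‖z 0‖ + e) := by
  obtain ⟨Δ, hΔ0, hΔ1, hΔ⟩ : ∃ Δ : ℝ, 0 < Δ ∧ Δ ≤ 1 ∧ 4 * E * Δ ^ α ≤ 1 := by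
    refine ⟨min 1 ((1 / (4 * E)) ^ (1 / α)), by positivity, min_le_left _ _, ?_⟩
    have h1 : (min 1 ((1 / (4 * E)) ^ (1 / α))) ^ α ≤ ((1 / (4 * E)) ^ (1 / α)) ^ α :=
      Real.rpow_le_rpow (by positivity) (min_le_right _ _) hα.le
    rw [← Real.rpow_mul (by positivity), one_div_mul_cancel hα.ne', Real.rpow_one] at h1
    calc _ ≤ 4 * E * (1 / (4 * E)) := by gcongr
      _ = 1 := by field_simp
  set n := ⌈T / Δ⌉₊ with hn
  refine ⟨2 ^ n * (2 * E + 2 / Δ ^ α + 1), by positivity, ?_⟩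
  intro V _ z e he ⟨K, hK⟩ hself
  have hmono : ∀ r : ℝ, 0 ≤ r → r ≤ Δ → r ^ α ≤ Δ ^ α := fun r h0 h1 =>
    Real.rpow_le_rpow h0 h1 hα.le
  have hloc : ∀ a b : ℝ, 0 ≤ a → a ≤ b → b ≤ T → b - a ≤ Δ →
      HolderBoundOn α a b z (2 * E * (‖z a‖ + e)) := by
    intro a b ha hab hb hΔab
    have key := le_fixedPoint_mul_of_contraction {p : ℝ × ℝ | a ≤ p.1 ∧ p.1 ≤ p.2 ∧ p.2 ≤ b}
      (fun p => ‖z p.2 - z p.1‖) (fun p => (p.2 - p.1) ^ α)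
      (q := 1 / 2) (B := E * (‖z a‖ + e)) (K := |K|) (by norm_num) (by norm_num) (by positivity)
      (abs_nonneg _) ?_ ?_
    · intro s t hs hst ht
      convert key (s, t) ⟨hs, hst, ht⟩ using 2
      ring
    · rintro ⟨s, t⟩ ⟨hs, hst, ht⟩
      dsimp only at hs hst ht ⊢
      exact (hK s t (by linarith) hst (by linarith)).trans
        (mul_le_mul_of_nonneg_right (le_abs_self _) (by have := sub_nonneg.2 hst; positivity))
    · rintro H hH hHb ⟨s, t⟩ ⟨hs, hst, ht⟩
      dsimp only at hs hst ht ⊢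
      have hHab : HolderBoundOn α a b z H := fun s t hs hst ht => hHb (s, t) ⟨hs, hst, ht⟩
      have h1 := hself s t (by linarith) hst (by linarith) (by linarith) H hH
        fun s' t' hs' hst' ht' => hHab s' t' (by linarith) hst' (by linarith)
      have h2 := hHab.norm_le hα.le hH hs (by linarith)
      have h3 := hmono (t - s) (by linarith) (by linarith)
      have h4 := hmono (b - a) (by linarith) hΔab
      refine h1.trans (mul_le_mul_of_nonneg_right ?_ (by have := sub_nonneg.2 hst; positivity))
      calc E * (‖z s‖ + e + H * (t - s) ^ α) ≤
          E * (‖z a‖ + H * Δ ^ α + e + H * Δ ^ α) := by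
            have := mul_le_mul_of_nonneg_left h3 hH
            have := mul_le_mul_of_nonneg_left h4 hH
            gcongr; linarith
        _ = 1 / 2 * H * (4 * E * Δ ^ α) + E * (‖z a‖ + e) := by ring
        _ ≤ 1 / 2 * H * 1 + E * (‖z a‖ + e) := by gcongr
        _ = _ := by ring
  have hdouble : ∀ a b : ℝ, 0 ≤ a → a ≤ b → b ≤ T → b - a ≤ Δ →
      ‖z b‖ + e ≤ 2 * (‖z a‖ + e) := by
    intro a b ha hab hb hΔab
    have h1 := (hloc a b ha hab hb hΔab).norm_le hα.le (by positivity) hab le_rfl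
    have h2 := hmono (b - a) (by linarith) hΔab
    have h3 : 2 * E * (‖z a‖ + e) * (b - a) ^ α ≤ 2 * E * (‖z a‖ + e) * Δ ^ α := by gcongr
    have h4 : (4 * E * Δ ^ α) * (‖z a‖ + e) ≤ 1 * (‖z a‖ + e) := by gcongr
    have : 0 ≤ ‖z a‖ := norm_nonneg _
    linarith
  have hiter : ∀ k : ℕ, ∀ t : ℝ, 0 ≤ t → t ≤ T → t ≤ k * Δ →
      ‖z t‖ + e ≤ 2 ^ k * (‖z 0‖ + e) := by
    intro k
    induction k with
    | zero =>
      intro t h0 _ h1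
      obtain rfl : t = 0 := by apply le_antisymm _ h0; simpa using h1
      simp
    | succ k ih =>
      intro t h0 hT' h1
      push_cast at h1
      have h2 := hdouble (max 0 (t - Δ)) t (le_max_left _ _)
        (max_le h0 (by linarith)) hT' (by linarith [le_max_right 0 (t - Δ)])
      have h3 := ih (max 0 (t - Δ)) (le_max_left _ _) (max_le hT.le (by linarith))
        (max_le (by positivity) (by linarith))
      rw [pow_succ]
      linarith
  have hsup : ∀ t : ℝ, 0 ≤ t → t ≤ T → ‖z t‖ + e ≤ 2 ^ n * (‖z 0‖ + e) := by
    intro t h0 h1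
    refine hiter n t h0 h1 (h1.trans ?_)
    exact (div_le_iff₀ hΔ0).1 (Nat.le_ceil _)
  have hS : 0 ≤ 2 ^ n * (‖z 0‖ + e) := by positivity
  have hd : 0 < Δ ^ α := by positivity
  constructor
  · intro s t hs hst ht
    have hr : 0 ≤ (t - s) ^ α := by have := sub_nonneg.2 hst; positivity
    have hs' := hsup s hs (by linarith)
    have ht' := hsup t (by linarith) ht
    by_cases hΔs : t - s ≤ Δ
    · refine (hloc s t hs hst ht hΔs s t le_rfl hst le_rfl).trans
        (mul_le_mul_of_nonneg_right ?_ hr)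
      calc 2 * E * (‖z s‖ + e) ≤ 2 * E * (2 ^ n * (‖z 0‖ + e)) := by gcongr
        _ ≤ (2 * E + 2 / Δ ^ α + 1) * (2 ^ n * (‖z 0‖ + e)) := by
            gcongr
            have : 0 ≤ 2 / Δ ^ α := by positivity
            linarith
        _ = _ := by ring
    · have h1 : Δ ^ α ≤ (t - s) ^ α := Real.rpow_le_rpow hΔ0.le (by linarith) hα.le
      calc ‖z t - z s‖ ≤ ‖z t‖ + ‖z s‖ := norm_sub_le _ _
        _ ≤ 2 / Δ ^ α * (2 ^ n * (‖z 0‖ + e)) * Δ ^ α := by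
            rw [div_mul_eq_mul_div, div_mul_cancel₀ _ hd.ne']; linarith
        _ ≤ (2 * E + 2 / Δ ^ α + 1) * (2 ^ n * (‖z 0‖ + e)) * (t - s) ^ α := by
            gcongr; linarith
        _ = _ := by ring
  · intro t h0 h1
    refine (hsup t h0 h1).trans ?_
    have : 0 ≤ 2 / Δ ^ α := by positivity
    calc _ = 1 * (2 ^ n * (‖z 0‖ + e)) := by ring
      _ ≤ (2 * E + 2 / Δ ^ α + 1) * (2 ^ n * (‖z 0‖ + e)) := by gcongr; linarith
      _ = _ := by ring

/-- Product of Hölder gains over two adjacent intervals. -/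
theorem rpow_mul_rpow_rpow_le {α β p q r : ℝ} (hα : 0 ≤ α) (hβ : 0 ≤ β) (hp : 0 ≤ p)
    (hpr : p ≤ r) (hq : 0 ≤ q) (hqr : q ≤ r) (hαβ : α * (1 + β) ≠ 0) :
    p ^ α * (q ^ α) ^ β ≤ r ^ (α * (1 + β)) := by
  have hr : 0 ≤ r := hp.trans hpr
  have h : r ^ (α * (1 + β)) = r ^ α * (r ^ α) ^ β := by
    rw [← Real.rpow_mul hr, ← Real.rpow_add' hr (by convert hαβ using 1; ring)]
    ring_nf
  rw [h]
  gcongr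

theorem DriftBound.mono {V W : Type*} [NormedAddCommGroup V] [NormedAddCommGroup W]
    {α β lam T M M' : ℝ} {A : ℝ → V → W} (hA : DriftBound α β lam T M A) (hM : M ≤ M') :
    DriftBound α β lam T M' A where
  zero s t hs hst ht := (hA.zero s t hs hst ht).trans (by
    have := sub_nonneg.2 hst
    gcongr)
  holder s t hs hst ht R hR z w hz hw := (hA.holder s t hs hst ht R hR z w hz hw).trans (by
    have := sub_nonneg.2 hst
    gcongr)

theorem DriftBound.norm_sub_le {V W : Type*} [NormedAddCommGroup V] [NormedAddCommGroup W]
    {α β lam T M : ℝ} {A : ℝ → V → W} (hA : DriftBound α β lam T M A) (hM : 0 ≤ M) (hβ : 0 ≤ β)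
    (hβlam : β + lam ≤ 1) {s t : ℝ} (hs : 0 ≤ s) (hst : s ≤ t) (ht : t ≤ T) {R : ℝ} (hR : 1 ≤ R)
    {z : V} (hz : ‖z‖ ≤ R) :
    ‖A t z - A s z‖ ≤ 2 * M * R * (t - s) ^ α := by
  have h1 := hA.zero s t hs hst ht
  have h2 := hA.holder s t hs hst ht R hR z 0 hz (by simp; linarith)
  rw [sub_zero] at h2
  have hr : 0 ≤ (t - s) ^ α := by have := sub_nonneg.2 hst; positivity
  have h3 : R ^ lam * ‖z‖ ^ β ≤ R := by
    calc R ^ lam * ‖z‖ ^ β ≤ R ^ lam * R ^ β := by gcongr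
      _ = R ^ (lam + β) := (Real.rpow_add (by linarith) _ _).symm
      _ ≤ R ^ (1 : ℝ) := Real.rpow_le_rpow_of_exponent_le hR (by linarith)
      _ = R := Real.rpow_one R
  have h4 : A t z - A s z = (A t z - A s z - (A t 0 - A s 0)) + (A t 0 - A s 0) := by abel
  calc ‖A t z - A s z‖ ≤ M * R ^ lam * (t - s) ^ α * ‖z‖ ^ β + M * (t - s) ^ α := by
        rw [h4]; exact (norm_add_le _ _).trans (add_le_add h2 h1)
    _ = M * (t - s) ^ α * (R ^ lam * ‖z‖ ^ β + 1) := by ring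
    _ ≤ M * (t - s) ^ α * (R + R) := by gcongr
    _ = _ := by ring

/-- Four-point estimate for a map with Hölder derivative on a ball. -/
theorem norm_four_point_le_s10 {V : Type*} [NormedAddCommGroup V] [NormedSpace ℝ V]
    {F : V → V} {F' : V → V →L[ℝ] V} {Q G K β h : ℝ} (hβ : 0 ≤ β) (hK : 0 ≤ K)
    (hF : ∀ z, HasFDerivAt F (F' z) z) (hG : ∀ z, ‖z‖ ≤ Q → ‖F' z‖ ≤ G)
    (hF' : ∀ z w, ‖z‖ ≤ Q → ‖w‖ ≤ Q → ‖F' z - F' w‖ ≤ K * ‖z - w‖ ^ β)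
    {a b c d : V} (ha : ‖a‖ ≤ Q) (hb : ‖b‖ ≤ Q) (hc : ‖c‖ ≤ Q) (hd : ‖d‖ ≤ Q)
    (hac : ‖a - c‖ ≤ h) (hbd : ‖b - d‖ ≤ h) :
    ‖F a - F b - (F c - F d)‖ ≤ G * ‖a - b - (c - d)‖ + K * h ^ β * ‖c - d‖ := by
  have hseg : ∀ (u v : V) (r : ℝ), ‖u‖ ≤ r → ‖v‖ ≤ r → ∀ θ ∈ Set.Icc (0 : ℝ) 1,
      ‖v + θ • (u - v)‖ ≤ r := by
    intro u v r hu hv θ hθ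
    have h1 : v + θ • (u - v) = (1 - θ) • v + θ • u := by module
    rw [h1]
    have h2 := norm_add_le ((1 - θ) • v) (θ • u)
    rw [norm_smul, norm_smul, Real.norm_of_nonneg (sub_nonneg.2 hθ.2),
      Real.norm_of_nonneg hθ.1] at h2
    nlinarith [mul_le_mul_of_nonneg_left hu hθ.1,
      mul_le_mul_of_nonneg_left hv (sub_nonneg.2 hθ.2)]
  have hline : ∀ (u v : V) (θ : ℝ), HasDerivAt (fun θ : ℝ => F (v + θ • (u - v)))
      (F' (v + θ • (u - v)) (u - v)) θ := by
    intro u v θ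
    have h1 : HasDerivAt (fun θ : ℝ => v + θ • (u - v)) (u - v) θ := by
      simpa using ((hasDerivAt_id θ).smul_const (u - v)).const_add v
    exact (hF _).comp_hasDerivAt θ h1
  have key := norm_image_sub_le_of_norm_deriv_le_segment_01'
    (f := fun θ : ℝ => F (b + θ • (a - b)) - F (d + θ • (c - d)))
    (f' := fun θ : ℝ => F' (b + θ • (a - b)) (a - b) - F' (d + θ • (c - d)) (c - d))
    (C := G * ‖a - b - (c - d)‖ + K * h ^ β * ‖c - d‖)
    (fun θ _ => ((hline a b θ).sub (hline c d θ)).hasDerivWithinAt) ?_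
  · have h1 : F a - F b - (F c - F d) = F a - F c - (F b - F d) := by abel
    simpa [h1] using key
  intro θ hθ
  have hθ' : θ ∈ Set.Icc (0 : ℝ) 1 := ⟨hθ.1, hθ.2.le⟩
  have hp := hseg a b Q ha hb θ hθ'
  have hq := hseg c d Q hc hd θ hθ'
  have hpq : ‖b + θ • (a - b) - (d + θ • (c - d))‖ ≤ h := by
    have := hseg (a - c) (b - d) h hac hbd θ hθ'
    convert this using 2
    module
  have h1 : F' (b + θ • (a - b)) (a - b) - F' (d + θ • (c - d)) (c - d) =
      F' (b + θ • (a - b)) (a - b - (c - d)) +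
        (F' (b + θ • (a - b)) - F' (d + θ • (c - d))) (c - d) := by
    simp only [map_sub, sub_apply]; abel
  rw [h1]
  refine (norm_add_le _ _).trans (add_le_add ?_ ?_)
  · exact ((F' _).le_opNorm _).trans (by gcongr; exact hG _ hp)
  · refine (ContinuousLinearMap.le_opNorm _ _).trans ?_
    gcongr
    exact (hF' _ _ hp hq).trans (by gcongr)

/-- The localized sewing bound yields a remainder of order `α(1+β)` with a fixed constant. -/
theorem YoungSolution.of_localized {V : Type*} [NormedAddCommGroup V] {α β lam T K : ℝ}
    (hα : 0 ≤ α) (hβ : 0 ≤ β) (hlam : 0 ≤ lam) (hT : 0 ≤ T) {A : ℝ → V → V} {x : ℝ → V}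
    (hK : HolderBoundOn α 0 T x K)
    (hx : ∃ κ : ℝ, 0 ≤ κ ∧ ∀ s t : ℝ, 0 ≤ s → s ≤ t → t ≤ T →
      ‖x t - x s - (A t (x s) - A s (x s))‖ ≤
        κ * (1 + supNormBetween s t x) ^ lam *
          holderSemiBetween α s t x ^ β * (t - s) ^ (α * (1 + β))) :
    YoungSolution α β T A x := by
  refine ⟨⟨K, hK⟩, ?_⟩
  obtain ⟨κ, hκ, hx⟩ := hx
  have hK' : HolderBoundOn α 0 T x |K| := fun s t hs hst ht =>
    (hK s t hs hst ht).trans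
      (mul_le_mul_of_nonneg_right (le_abs_self _) (by have := sub_nonneg.2 hst; positivity))
  refine ⟨κ * (1 + (‖x 0‖ + |K| * (T - 0) ^ α)) ^ lam * |K| ^ β, by positivity, ?_⟩
  intro s t hs hst ht
  have hsup0 : 0 ≤ supNormBetween s t x := by
    apply Real.sSup_nonneg
    rintro _ ⟨v, -, -, rfl⟩
    exact norm_nonneg _
  have hsup : supNormBetween s t x ≤ ‖x 0‖ + |K| * (T - 0) ^ α := by
    apply Real.sSup_le _ (by simp only [sub_zero]; positivity)
    rintro _ ⟨v, hv, hv', rfl⟩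
    exact hK'.norm_le hα (abs_nonneg K) (by linarith) (by linarith)
  have hsem0 : 0 ≤ holderSemiBetween α s t x := by
    apply Real.sSup_nonneg
    rintro _ ⟨u, v, -, huv, -, rfl⟩
    have := sub_pos.2 huv
    positivity
  have hsem : holderSemiBetween α s t x ≤ |K| := by
    apply Real.sSup_le _ (abs_nonneg K)
    rintro _ ⟨u, v, hu, huv, hv, rfl⟩
    have := sub_pos.2 huv
    rw [div_le_iff₀ (by positivity)]
    exact hK' u v (by linarith) huv.le (by linarith)
  have := sub_nonneg.2 hst
  exact (hx s t hs hst ht).trans (by gcongr)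

/-- A priori estimate: solutions are bounded and Hölder, uniformly in the data. -/
theorem exists_apriori_bound {α β lam T L : ℝ} (hα : 0 < α) (hβ : 0 < β) (hlam : 0 < lam)
    (hαβ : 1 < α * (1 + β)) (hβlam : β + lam ≤ 1) (hT : 0 < T) (hL : 0 < L) :
    ∃ Q : ℝ, 1 ≤ Q ∧ ∀ {V : Type*} [NormedAddCommGroup V] (A : ℝ → V → V) (x : ℝ → V),
      DriftBound α β lam T L A → YoungSolution α β T A x → ‖x 0‖ ≤ L →
        HolderBoundOn α 0 T x Q ∧ ∀ t : ℝ, 0 ≤ t → t ≤ T → ‖x t‖ ≤ Q := by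
  have hq : (2 : ℝ) ^ (1 - α * (1 + β)) < 1 :=
    Real.rpow_lt_one_of_one_lt_of_neg (by norm_num) (by linarith)
  set c := 1 - (2 : ℝ) ^ (1 - α * (1 + β)) with hc
  have hc0 : 0 < c := by linarith
  obtain ⟨C, hC, hmain⟩ := exists_holderBoundOn_of_selfBound (α := α) (T := T)
    (E := 2 * L + L / c) hα hT (by positivity)
  refine ⟨1 + C * (L + 1), by nlinarith [mul_nonneg hC hL.le], ?_⟩
  intro V _ A x hA hx hx0
  have hCL : C * (‖x 0‖ + 1) ≤ 1 + C * (L + 1) := by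
    have : C * (‖x 0‖ + 1) ≤ C * (L + 1) := by gcongr
    linarith
  suffices hself : ∀ s t : ℝ, 0 ≤ s → s ≤ t → t ≤ T → t - s ≤ 1 → ∀ H : ℝ, 0 ≤ H →
      HolderBoundOn α s t x H →
      ‖x t - x s‖ ≤ (2 * L + L / c) * (‖x s‖ + 1 + H * (t - s) ^ α) * (t - s) ^ α by
    obtain ⟨h1, h2⟩ := hmain x 1 zero_le_one hx.holder hself
    refine ⟨fun s t hs hst ht => (h1 s t hs hst ht).trans (mul_le_mul_of_nonneg_right hCL
      (by have := sub_nonneg.2 hst; positivity)), fun t h0 ht => ?_⟩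
    linarith [h2 t h0 ht]
  intro s t hs hst ht _ H hH hHb
  have hts := sub_nonneg.2 hst
  set P := ‖x s‖ + 1 + H * (t - s) ^ α with hP
  have hHr : 0 ≤ H * (t - s) ^ α := by positivity
  have hP1 : 1 ≤ P := by linarith [norm_nonneg (x s)]
  have hsup : ∀ v, s ≤ v → v ≤ t → ‖x v‖ ≤ P := fun v h h' => by
    linarith [hHb.norm_le hα.le hH h h']
  obtain ⟨κ, hκ, hrem⟩ := hx.remainder
  have hsew := sewing_remainder_le hαβ hκ (B := L * P ^ lam * H ^ β) (by positivity) x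
    (fun s t => A t (x s) - A s (x s)) (a := s) (b := t)
    (fun s' t' hs' hst' ht' => hrem s' t' (by linarith) hst' (by linarith)) ?_
    s t le_rfl hst le_rfl
  · have h3 := hA.norm_sub_le hL.le hβ.le hβlam hs hst ht hP1 (hsup s le_rfl hst)
    have h4 : x t - x s = x t - x s - (A t (x s) - A s (x s)) + (A t (x s) - A s (x s)) := by abel
    have h5 : (t - s) ^ (α * (1 + β)) = (t - s) ^ α * ((t - s) ^ α) ^ β := by
      rw [← Real.rpow_mul hts, ← Real.rpow_add' hts (by nlinarith)]
      ring_nf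
    have h6 : P ^ lam * (H ^ β * ((t - s) ^ α) ^ β) ≤ P := by
      rw [← Real.mul_rpow hH (by positivity)]
      calc P ^ lam * (H * (t - s) ^ α) ^ β ≤ P ^ lam * P ^ β := by
            gcongr; linarith [norm_nonneg (x s)]
        _ = P ^ (lam + β) := (Real.rpow_add (by linarith) _ _).symm
        _ ≤ P ^ (1 : ℝ) := Real.rpow_le_rpow_of_exponent_le hP1 (by linarith)
        _ = P := Real.rpow_one P
    calc ‖x t - x s‖ ≤ L * P ^ lam * H ^ β / c * (t - s) ^ (α * (1 + β)) +
          2 * L * P * (t - s) ^ α := by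
          rw [h4]; exact (norm_add_le _ _).trans (add_le_add hsew h3)
      _ = (L / c) * (P ^ lam * (H ^ β * ((t - s) ^ α) ^ β)) * (t - s) ^ α +
          2 * L * P * (t - s) ^ α := by rw [h5]; ring
      _ ≤ (L / c) * P * (t - s) ^ α + 2 * L * P * (t - s) ^ α := by gcongr
      _ = _ := by ring
  · intro s' u t' hs' hsu hut ht'
    have h7 : A t' (x s') - A s' (x s') - (A u (x s') - A s' (x s')) - (A t' (x u) - A u (x u)) =
        A t' (x s') - A u (x s') - (A t' (x u) - A u (x u)) := by abel
    have h8 := hA.holder u t' (by linarith) hut (by linarith) P hP1 (x s') (x u)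
      (hsup _ hs' (by linarith)) (hsup _ (by linarith) (by linarith))
    have h9 := hHb s' u hs' hsu (by linarith)
    have hut' := sub_nonneg.2 hut
    have hsu' := sub_nonneg.2 hsu
    rw [norm_sub_rev (x s')] at h8
    have h10 : ‖x u - x s'‖ ^ β ≤ H ^ β * ((u - s') ^ α) ^ β := by
      rw [← Real.mul_rpow hH (by positivity)]
      gcongr
    have h11 := rpow_mul_rpow_rpow_le hα.le hβ.le hut' (r := t' - s') (by linarith) hsu'
      (by linarith) (by linarith)
    rw [h7]
    calc _ ≤ L * P ^ lam * (t' - u) ^ α * (H ^ β * ((u - s') ^ α) ^ β) := h8.trans (by gcongr)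
      _ = L * P ^ lam * H ^ β * ((t' - u) ^ α * ((u - s') ^ α) ^ β) := by ring
      _ ≤ _ := by gcongr

set_option maxHeartbeats 1000000 in
/-- Hölder stability of solutions with respect to the initial datum and the drift. -/
theorem exists_stability_bound {α β lam T L : ℝ} (hα : 0 < α) (hβ : 0 < β) (hβ1 : β ≤ 1)
    (hlam : 0 < lam) (hαβ : 1 < α * (1 + β)) (hβlam : β + lam ≤ 1) (hT : 0 < T) (hL : 0 < L) :
    ∃ C : ℝ, 0 ≤ C ∧ ∀ {V : Type*} [NormedAddCommGroup V] [NormedSpace ℝ V]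
      (A₁ A₂ : ℝ → V → V) (DA₁ : ℝ → V → V →L[ℝ] V) (x₁ x₂ : ℝ → V) (D : ℝ), 0 ≤ D →
      DriftBound α β lam T L A₁ → DriftBound α β lam T L A₂ → DriftBound α β lam T L DA₁ →
      (∀ t : ℝ, ∀ z : V, 0 ≤ t → t ≤ T → HasFDerivAt (A₁ t) (DA₁ t z) z) →
      DriftBound α β lam T D (fun t z => A₁ t z - A₂ t z) →
      YoungSolution α β T A₁ x₁ → YoungSolution α β T A₂ x₂ → ‖x₁ 0‖ ≤ L → ‖x₂ 0‖ ≤ L →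
        HolderBoundOn α 0 T (fun t => x₁ t - x₂ t) (C * (‖x₁ 0 - x₂ 0‖ + D)) := by
  have hq : (2 : ℝ) ^ (1 - α * (1 + β)) < 1 :=
    Real.rpow_lt_one_of_one_lt_of_neg (by norm_num) (by linarith)
  set c := 1 - (2 : ℝ) ^ (1 - α * (1 + β)) with hc
  have hc0 : 0 < c := by linarith
  obtain ⟨Q, hQ, hapriori⟩ := exists_apriori_bound hα hβ hlam hαβ hβlam hT hL
  have hQ0 : 0 < Q := by linarith
  obtain ⟨C, hC, hmain⟩ := exists_holderBoundOn_of_selfBound (α := α) (T := T)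
    (E := 2 * L * Q + 2 * Q + (2 * L * Q + (L + 1) * Q * Q) / c) hα hT (by positivity)
  refine ⟨C, hC, ?_⟩
  intro V _ _ A₁ A₂ DA₁ x₁ x₂ D hD hA₁ hA₂ hDA₁ hderiv hdiff hx₁ hx₂ hi₁ hi₂
  obtain ⟨hH₁, hs₁⟩ := hapriori A₁ x₁ hA₁ hx₁ hi₁
  obtain ⟨hH₂, hs₂⟩ := hapriori A₂ x₂ hA₂ hx₂ hi₂
  have hQlam : Q ^ lam ≤ Q :=
    (Real.rpow_le_rpow_of_exponent_le hQ (by linarith)).trans (Real.rpow_one Q).le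
  have hQβ : Q ^ β ≤ Q :=
    (Real.rpow_le_rpow_of_exponent_le hQ (by linarith)).trans (Real.rpow_one Q).le
  have hfour : ∀ s t : ℝ, 0 ≤ s → s ≤ t → t ≤ T → ∀ (a b d e : V) (h : ℝ), ‖a‖ ≤ Q → ‖b‖ ≤ Q →
      ‖d‖ ≤ Q → ‖e‖ ≤ Q → ‖a - d‖ ≤ h → ‖b - e‖ ≤ h →
      ‖A₁ t a - A₁ s a - (A₁ t b - A₁ s b) - (A₁ t d - A₁ s d - (A₁ t e - A₁ s e))‖ ≤
        2 * L * Q * (t - s) ^ α * ‖a - b - (d - e)‖ +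
          L * Q * (t - s) ^ α * h ^ β * ‖d - e‖ := by
    intro s t hs hst ht a b d e h ha hb hd he had hbe
    have hr : 0 ≤ (t - s) ^ α := by have := sub_nonneg.2 hst; positivity
    refine norm_four_point_le_s10 (F := fun z => A₁ t z - A₁ s z) (F' := fun z => DA₁ t z - DA₁ s z)
      hβ.le (by positivity)
      (fun z => (hderiv t z (by linarith) ht).sub (hderiv s z hs (by linarith)))
      (fun z hz => hDA₁.norm_sub_le hL.le hβ.le hβlam hs hst ht hQ hz) ?_ ha hb hd he had hbe
    intro z w hz hw
    refine (hDA₁.holder s t hs hst ht Q hQ z w hz hw).trans ?_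
    gcongr
  refine (hmain (fun t => x₁ t - x₂ t) D hD ?_ ?_).1
  · refine ⟨Q + Q, fun s t hs hst ht => ?_⟩
    rw [show x₁ t - x₂ t - (x₁ s - x₂ s) = (x₁ t - x₁ s) - (x₂ t - x₂ s) by abel, add_mul]
    exact (norm_sub_le _ _).trans (add_le_add (hH₁ s t hs hst ht) (hH₂ s t hs hst ht))
  intro s t hs hst ht hts1 H hH hHb
  have hts := sub_nonneg.2 hst
  set P := ‖x₁ s - x₂ s‖ + D + H * (t - s) ^ α with hP
  have hHr : 0 ≤ H * (t - s) ^ α := by positivity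
  have hHP : H * (t - s) ^ α ≤ P := by linarith [norm_nonneg (x₁ s - x₂ s)]
  have hDP : D ≤ P := by linarith [norm_nonneg (x₁ s - x₂ s)]
  have hP0 : 0 ≤ P := hD.trans hDP
  have hsup : ∀ v, s ≤ v → v ≤ t → ‖x₁ v - x₂ v‖ ≤ P := fun v h h' => by
    linarith [hHb.norm_le hα.le hH h h']
  obtain ⟨κ₁, hκ₁, hrem₁⟩ := hx₁.remainder
  obtain ⟨κ₂, hκ₂, hrem₂⟩ := hx₂.remainder
  have hsew := sewing_remainder_le hαβ (add_nonneg hκ₁ hκ₂)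
    (B := 2 * L * Q * H * (t - s) ^ (α * (1 - β)) + (L + 1) * Q * Q * P)
    (by positivity) (fun t => x₁ t - x₂ t)
    (fun s t => A₁ t (x₁ s) - A₁ s (x₁ s) - (A₂ t (x₂ s) - A₂ s (x₂ s))) (a := s) (b := t)
    (fun s' t' hs' hst' ht' => ?_) ?_ s t le_rfl hst le_rfl
  · have h1 := hfour s t hs hst ht (x₁ s) (x₂ s) 0 0 Q (hs₁ s hs (by linarith))
      (hs₂ s hs (by linarith)) (by simpa using hQ0.le) (by simpa using hQ0.le)
      (by simpa using hs₁ s hs (by linarith)) (by simpa using hs₂ s hs (by linarith))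
    have h2 := hdiff.norm_sub_le hD hβ.le hβlam hs hst ht hQ (hs₂ s hs (by linarith))
    simp only [sub_self, sub_zero, norm_zero, mul_zero, add_zero] at h1
    have h3 : x₁ t - x₂ t - (x₁ s - x₂ s) =
        x₁ t - x₂ t - (x₁ s - x₂ s) - (A₁ t (x₁ s) - A₁ s (x₁ s) - (A₂ t (x₂ s) - A₂ s (x₂ s))) +
        (A₁ t (x₁ s) - A₁ s (x₁ s) - (A₁ t (x₂ s) - A₁ s (x₂ s))) +
        (A₁ t (x₂ s) - A₂ t (x₂ s) - (A₁ s (x₂ s) - A₂ s (x₂ s))) := by abel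
    have h4 : (t - s) ^ (α * (1 - β)) * (t - s) ^ (α * (1 + β)) = (t - s) ^ α * (t - s) ^ α := by
      rw [← Real.rpow_add' hts (by nlinarith), ← Real.rpow_add' hts (by positivity)]
      ring_nf
    have h5 : (t - s) ^ (α * (1 + β)) ≤ (t - s) ^ α :=
      Real.rpow_le_rpow_of_exponent_ge' hts hts1 hα.le (by nlinarith)
    calc ‖x₁ t - x₂ t - (x₁ s - x₂ s)‖ ≤
          (2 * L * Q * H * (t - s) ^ (α * (1 - β)) + (L + 1) * Q * Q * P) / c *
            (t - s) ^ (α * (1 + β)) + 2 * L * Q * (t - s) ^ α * ‖x₁ s - x₂ s‖ +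
            2 * D * Q * (t - s) ^ α := by
          rw [h3]
          exact (norm_add_le _ _).trans (add_le_add ((norm_add_le _ _).trans
            (add_le_add hsew h1)) h2)
      _ = 2 * L * Q / c * (H * ((t - s) ^ (α * (1 - β)) * (t - s) ^ (α * (1 + β)))) +
          (L + 1) * Q * Q / c * P * (t - s) ^ (α * (1 + β)) +
          2 * L * Q * (t - s) ^ α * ‖x₁ s - x₂ s‖ + 2 * D * Q * (t - s) ^ α := by ring
      _ = 2 * L * Q / c * (H * (t - s) ^ α) * (t - s) ^ α +
          (L + 1) * Q * Q / c * P * (t - s) ^ (α * (1 + β)) +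
          2 * L * Q * (t - s) ^ α * ‖x₁ s - x₂ s‖ + 2 * D * Q * (t - s) ^ α := by rw [h4]; ring
      _ ≤ 2 * L * Q / c * P * (t - s) ^ α +
          (L + 1) * Q * Q / c * P * (t - s) ^ α +
          2 * L * Q * (t - s) ^ α * P + 2 * P * Q * (t - s) ^ α := by
          gcongr
          exact hsup s le_rfl hst
      _ = _ := by ring
  · have h1 := hrem₁ s' t' (by linarith) hst' (by linarith)
    have h2 := hrem₂ s' t' (by linarith) hst' (by linarith)
    rw [show x₁ t' - x₂ t' - (x₁ s' - x₂ s') -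
        (A₁ t' (x₁ s') - A₁ s' (x₁ s') - (A₂ t' (x₂ s') - A₂ s' (x₂ s'))) =
        x₁ t' - x₁ s' - (A₁ t' (x₁ s') - A₁ s' (x₁ s')) -
        (x₂ t' - x₂ s' - (A₂ t' (x₂ s') - A₂ s' (x₂ s'))) by abel, add_mul]
    exact (norm_sub_le _ _).trans (add_le_add h1 h2)
  · intro s' u t' hs' hsu hut ht'
    have hut' := sub_nonneg.2 hut
    have hsu' := sub_nonneg.2 hsu
    have hst' : 0 ≤ t' - s' := by linarith
    have h0s' : 0 ≤ s' := by linarith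
    have h1 := hfour u t' (by linarith) hut (by linarith) (x₁ s') (x₂ s') (x₁ u) (x₂ u)
      (Q * (u - s') ^ α) (hs₁ _ h0s' (by linarith)) (hs₂ _ h0s' (by linarith))
      (hs₁ _ (by linarith) (by linarith)) (hs₂ _ (by linarith) (by linarith))
      (by rw [norm_sub_rev]; exact hH₁ s' u h0s' hsu (by linarith))
      (by rw [norm_sub_rev]; exact hH₂ s' u h0s' hsu (by linarith))
    have h2 := hdiff.holder u t' (by linarith) hut (by linarith) Q hQ (x₂ s') (x₂ u)
      (hs₂ _ h0s' (by linarith)) (hs₂ _ (by linarith) (by linarith))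
    have h3 : ‖x₂ s' - x₂ u‖ ≤ Q * (u - s') ^ α := by
      rw [norm_sub_rev]; exact hH₂ s' u h0s' hsu (by linarith)
    have h4 : ‖x₁ s' - x₂ s' - (x₁ u - x₂ u)‖ ≤ H * (u - s') ^ α := by
      rw [norm_sub_rev]; exact hHb s' u hs' hsu (by linarith)
    have h5 := rpow_mul_rpow_rpow_le hα.le hβ.le hut' (r := t' - s') (by linarith) hsu'
      (by linarith) (by linarith)
    have h6 : (Q * (u - s') ^ α) ^ β ≤ Q * ((u - s') ^ α) ^ β := by
      rw [Real.mul_rpow hQ0.le (by positivity)]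
      gcongr
    have h7 : (t' - u) ^ α * (u - s') ^ α ≤
        (t - s) ^ (α * (1 - β)) * (t' - s') ^ (α * (1 + β)) := by
      have hβ' : 0 ≤ α * (1 - β) := mul_nonneg hα.le (by linarith)
      calc (t' - u) ^ α * (u - s') ^ α ≤ (t' - s') ^ α * (t' - s') ^ α := by
            gcongr
        _ = (t' - s') ^ (α * (1 - β)) * (t' - s') ^ (α * (1 + β)) := by
            rw [← Real.rpow_add' hst' (by positivity), ← Real.rpow_add' hst' (by nlinarith)]
            ring_nf
        _ ≤ _ := by gcongr
    rw [show A₁ t' (x₁ s') - A₁ s' (x₁ s') - (A₂ t' (x₂ s') - A₂ s' (x₂ s')) -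
        (A₁ u (x₁ s') - A₁ s' (x₁ s') - (A₂ u (x₂ s') - A₂ s' (x₂ s'))) -
        (A₁ t' (x₁ u) - A₁ u (x₁ u) - (A₂ t' (x₂ u) - A₂ u (x₂ u))) =
        (A₁ t' (x₁ s') - A₁ u (x₁ s') - (A₁ t' (x₂ s') - A₁ u (x₂ s')) -
          (A₁ t' (x₁ u) - A₁ u (x₁ u) - (A₁ t' (x₂ u) - A₁ u (x₂ u)))) +
        (A₁ t' (x₂ s') - A₂ t' (x₂ s') - (A₁ u (x₂ s') - A₂ u (x₂ s')) -
          (A₁ t' (x₂ u) - A₂ t' (x₂ u) - (A₁ u (x₂ u) - A₂ u (x₂ u)))) by abel]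
    calc _ ≤ 2 * L * Q * (t' - u) ^ α * (H * (u - s') ^ α) +
          L * Q * (t' - u) ^ α * (Q * ((u - s') ^ α) ^ β) * P +
          P * Q * (t' - u) ^ α * (Q * ((u - s') ^ α) ^ β) := by
          refine (norm_add_le _ _).trans (add_le_add (h1.trans ?_) (h2.trans ?_))
          · gcongr
            exact hsup u (by linarith) (by linarith)
          · have : ‖x₂ s' - x₂ u‖ ^ β ≤ Q * ((u - s') ^ α) ^ β := by
              refine le_trans ?_ h6
              gcongr
            gcongr
      _ = 2 * L * Q * H * ((t' - u) ^ α * (u - s') ^ α) +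
          (L + 1) * Q * Q * P * ((t' - u) ^ α * ((u - s') ^ α) ^ β) := by ring
      _ ≤ 2 * L * Q * H * ((t - s) ^ (α * (1 - β)) * (t' - s') ^ (α * (1 + β))) +
          (L + 1) * Q * Q * P * (t' - s') ^ (α * (1 + β)) := by gcongr
      _ = _ := by ring

/-- **Comparison principle for nonlinear YDEs.**  For `α(1+β) > 1`, `β + λ ≤ 1`, initial data
bounded by `R` and drifts `A¹, A² ∈ C^α_t C^{β,λ}_V` bounded by `M` (with `A¹` additionally
spatially differentiable with `‖A¹‖_{α,1+β,λ} ≤ M`), any two solutions `x¹, x²` of the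
respective YDEs satisfy `⟦x¹ - x²⟧_α ≤ C (‖x₀¹ - x₀²‖ + ‖A¹ - A²‖_{α,β,λ})` with a constant
`C = C(α,β,T,R,M)` increasing in `R` and `M`. -/
theorem comparison_principle
    {V : Type*} [NormedAddCommGroup V] [NormedSpace ℝ V]
    (α β lam : ℝ) (hα0 : 0 < α) (hα1 : α < 1) (hβ0 : 0 < β) (hβ1 : β < 1)
    (hαβ : 1 < α * (1 + β)) (hlam0 : 0 < lam) (hlam1 : lam ≤ 1) (hβlam : β + lam ≤ 1)
    (T : ℝ) (hT : 0 < T) :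
    ∃ C : ℝ → ℝ → ℝ,
      (∀ R M : ℝ, 0 ≤ C R M) ∧
      (∀ R R' M M' : ℝ, R ≤ R' → M ≤ M' → C R M ≤ C R' M') ∧
      ∀ (R M : ℝ), 0 < R → 0 < M →
      ∀ (x₀₁ x₀₂ : V) (A₁ A₂ : ℝ → V → V) (DA₁ : ℝ → V → (V →L[ℝ] V))
        (x₁ x₂ : ℝ → V) (K₁ K₂ D : ℝ),
        ‖x₀₁‖ ≤ R → ‖x₀₂‖ ≤ R →
        (∀ z : V, A₁ 0 z = 0) → (∀ z : V, A₂ 0 z = 0) →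
        (∀ s t : ℝ, 0 ≤ s → s ≤ t → t ≤ T →
          ‖A₁ t 0 - A₁ s 0‖ ≤ M * (t - s) ^ α) →
        (∀ s t : ℝ, 0 ≤ s → s ≤ t → t ≤ T → ∀ R' : ℝ, 1 ≤ R' → ∀ z w : V,
          ‖z‖ ≤ R' → ‖w‖ ≤ R' →
          ‖A₁ t z - A₁ s z - (A₁ t w - A₁ s w)‖ ≤
            M * R' ^ lam * (t - s) ^ α * ‖z - w‖ ^ β) →
        (∀ s t : ℝ, 0 ≤ s → s ≤ t → t ≤ T →
          ‖A₂ t 0 - A₂ s 0‖ ≤ M * (t - s) ^ α) →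
        (∀ s t : ℝ, 0 ≤ s → s ≤ t → t ≤ T → ∀ R' : ℝ, 1 ≤ R' → ∀ z w : V,
          ‖z‖ ≤ R' → ‖w‖ ≤ R' →
          ‖A₂ t z - A₂ s z - (A₂ t w - A₂ s w)‖ ≤
            M * R' ^ lam * (t - s) ^ α * ‖z - w‖ ^ β) →
        (∀ t : ℝ, ∀ z : V, 0 ≤ t → t ≤ T → HasFDerivAt (A₁ t) (DA₁ t z) z) →
        (∀ s t : ℝ, 0 ≤ s → s ≤ t → t ≤ T →
          ‖DA₁ t 0 - DA₁ s 0‖ ≤ M * (t - s) ^ α) →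
        (∀ s t : ℝ, 0 ≤ s → s ≤ t → t ≤ T → ∀ R' : ℝ, 1 ≤ R' → ∀ z w : V,
          ‖z‖ ≤ R' → ‖w‖ ≤ R' →
          ‖DA₁ t z - DA₁ s z - (DA₁ t w - DA₁ s w)‖ ≤
            M * R' ^ lam * (t - s) ^ α * ‖z - w‖ ^ β) →
        (∀ s t : ℝ, 0 ≤ s → s ≤ t → t ≤ T →
          ‖(A₁ t 0 - A₂ t 0) - (A₁ s 0 - A₂ s 0)‖ ≤ D * (t - s) ^ α) →
        (∀ s t : ℝ, 0 ≤ s → s ≤ t → t ≤ T → ∀ R' : ℝ, 1 ≤ R' → ∀ z w : V,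
          ‖z‖ ≤ R' → ‖w‖ ≤ R' →
          ‖(A₁ t z - A₂ t z) - (A₁ s z - A₂ s z) -
              ((A₁ t w - A₂ t w) - (A₁ s w - A₂ s w))‖ ≤
            D * R' ^ lam * (t - s) ^ α * ‖z - w‖ ^ β) →
        x₁ 0 = x₀₁ → x₂ 0 = x₀₂ →
        (∀ s t : ℝ, 0 ≤ s → s ≤ t → t ≤ T → ‖x₁ t - x₁ s‖ ≤ K₁ * (t - s) ^ α) →
        (∀ s t : ℝ, 0 ≤ s → s ≤ t → t ≤ T → ‖x₂ t - x₂ s‖ ≤ K₂ * (t - s) ^ α) →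
        (∃ κ : ℝ, 0 ≤ κ ∧ ∀ s t : ℝ, 0 ≤ s → s ≤ t → t ≤ T →
          ‖x₁ t - x₁ s - (A₁ t (x₁ s) - A₁ s (x₁ s))‖ ≤
            κ * (1 + supNormBetween s t x₁) ^ lam *
              holderSemiBetween α s t x₁ ^ β * (t - s) ^ (α * (1 + β))) →
        (∃ κ : ℝ, 0 ≤ κ ∧ ∀ s t : ℝ, 0 ≤ s → s ≤ t → t ≤ T →
          ‖x₂ t - x₂ s - (A₂ t (x₂ s) - A₂ s (x₂ s))‖ ≤
            κ * (1 + supNormBetween s t x₂) ^ lam *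
              holderSemiBetween α s t x₂ ^ β * (t - s) ^ (α * (1 + β))) →
        ∀ s t : ℝ, 0 ≤ s → s ≤ t → t ≤ T →
          ‖(x₁ t - x₂ t) - (x₁ s - x₂ s)‖ ≤
            C R M * (‖x₀₁ - x₀₂‖ + D) * (t - s) ^ α := by
  have hbound : ∀ n : ℕ, ∃ C : ℝ, 0 ≤ C ∧ ∀ (A₁ A₂ : ℝ → V → V) (DA₁ : ℝ → V → V →L[ℝ] V)
      (x₁ x₂ : ℝ → V) (D : ℝ), 0 ≤ D →
      DriftBound α β lam T (n + 1) A₁ → DriftBound α β lam T (n + 1) A₂ →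
      DriftBound α β lam T (n + 1) DA₁ →
      (∀ t : ℝ, ∀ z : V, 0 ≤ t → t ≤ T → HasFDerivAt (A₁ t) (DA₁ t z) z) →
      DriftBound α β lam T D (fun t z => A₁ t z - A₂ t z) →
      YoungSolution α β T A₁ x₁ → YoungSolution α β T A₂ x₂ →
      ‖x₁ 0‖ ≤ n + 1 → ‖x₂ 0‖ ≤ n + 1 →
        HolderBoundOn α 0 T (fun t => x₁ t - x₂ t) (C * (‖x₁ 0 - x₂ 0‖ + D)) := by
    intro n
    obtain ⟨C, hC, h⟩ := exists_stability_bound hα0 hβ0 hβ1.le hlam0 hαβ hβlam hT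
      (L := (n : ℝ) + 1) (by positivity)
    exact ⟨C, hC, h⟩
  choose c hc0 hc using hbound
  refine ⟨fun R M => ∑ k ∈ Finset.range (⌈max R M⌉₊ + 1), c k,
    fun R M => Finset.sum_nonneg fun k _ => hc0 k, ?_, ?_⟩
  · intro R R' M M' hR hM
    refine Finset.sum_le_sum_of_subset_of_nonneg ?_ fun k _ _ => hc0 k
    gcongr
  intro R M _ _ x₀₁ x₀₂ A₁ A₂ DA₁ x₁ x₂ K₁ K₂ D hR₁ hR₂ _ _ hA₁z hA₁ hA₂z hA₂ hderiv hDz hDA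
    hdz hd h₁ h₂ hK₁ hK₂ hsol₁ hsol₂ s t hs hst ht
  set n := ⌈max R M⌉₊
  have hn : max R M ≤ n := Nat.le_ceil _
  have hRn : R ≤ (n : ℝ) + 1 := by linarith [le_max_left R M]
  have hMn : M ≤ (n : ℝ) + 1 := by linarith [le_max_right R M]
  have hD : 0 ≤ D := by
    have h0 := (norm_nonneg _).trans (hdz 0 T le_rfl hT.le le_rfl)
    rw [sub_zero] at h0
    exact nonneg_of_mul_nonneg_left h0 (by positivity)
  have key := hc n A₁ A₂ DA₁ x₁ x₂ D hD (DriftBound.mono ⟨hA₁z, hA₁⟩ hMn)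
    (DriftBound.mono ⟨hA₂z, hA₂⟩ hMn) (DriftBound.mono ⟨hDz, hDA⟩ hMn) hderiv ⟨hdz, hd⟩
    (YoungSolution.of_localized hα0.le hβ0.le hlam0.le hT.le hK₁ hsol₁)
    (YoungSolution.of_localized hα0.le hβ0.le hlam0.le hT.le hK₂ hsol₂)
    (by rw [h₁]; linarith) (by rw [h₂]; linarith) s t hs hst ht
  rw [h₁, h₂] at key
  refine key.trans ?_
  have hts := sub_nonneg.2 hst
  have hcn : c n ≤ ∑ k ∈ Finset.range (n + 1), c k :=
    Finset.single_le_sum (fun k _ => hc0 k) (Finset.self_mem_range_succ n)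
  gcongr
end
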